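/- arXiv:math/0609103 — 2 statements merged into one kernel-verified Lean document; each statement's English description precedes it below -/
import Mathlib

section
/- Let n ≥ 3. There exist ε₀ > 0 and C > 0, depending only on n, such that for every open set Ω ⊆ ℝⁿ, every smooth solution u of −Δu = u|u|^{4/(n−2)} on Ω, every point x₀ and every radius r > 0 with the closed ball B(x₀,r) contained in Ω: if ∫_{B(x₀,r)} ( |∇u|² + |u|^{2n/(n−2)} ) dy ≤ ε₀, then sup_{y ∈ B(x₀, r/4)} |u(y)| ≤ C · r^{−(n−2)/2}. -/
open MeasureTheory Metric Filter Topology Set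
open scoped ENNReal NNReal RealInnerProductSpace

noncomputable section

abbrev En (n : ℕ) := EuclideanSpace ℝ (Fin n)

/-- The Euclidean Laplacian, as the sum of second directional derivatives. -/
def lap {n : ℕ} (u : En n → ℝ) (x : En n) : ℝ :=
  ∑ i : Fin n, fderiv ℝ (fun y => fderiv ℝ u y (EuclideanSpace.single i 1)) x
    (EuclideanSpace.single i 1)

/-- A smooth solution of the Yamabe-type equation `-Δu = u|u|^{4/(n-2)}` on `Ω`. -/
def IsYamabeSol (n : ℕ) (Ω : Set (En n)) (u : En n → ℝ) : Prop :=
  ContDiffOn ℝ (⊤ : ℕ∞) u Ω ∧ ∀ x ∈ Ω, -lap u x = u x * |u x| ^ ((4 : ℝ) / ((n : ℝ) - 2))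

/-- The monotone quantity `E_u(x,r)`. -/
def Eu (n : ℕ) (u : En n → ℝ) (x : En n) (r : ℝ) : ℝ :=
  (∫ y in closedBall x r,
      ((1 : ℝ) / 2 * ‖gradient u y‖ ^ 2
        - ((n : ℝ) - 2) / (2 * n) * |u y| ^ (2 * (n : ℝ) / ((n : ℝ) - 2))))
  + ((n : ℝ) - 2) / (4 * r) * ∫ y in sphere x r, (u y) ^ 2 ∂(μH[(n : ℝ) - 1])

/-- Outward radial (normal) derivative of `u` on the sphere centered at `x`. -/
def nder {n : ℕ} (u : En n → ℝ) (x z : En n) : ℝ := ⟪gradient u z, z - x⟫ / ‖z - x‖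

/-- Energy density `½|∇u|² + ((n-2)/(2n))|u|^{2n/(n-2)}`. -/
def eDen (n : ℕ) (u : En n → ℝ) (y : En n) : ℝ :=
  (1 : ℝ) / 2 * ‖gradient u y‖ ^ 2
    + ((n : ℝ) - 2) / (2 * n) * |u y| ^ (2 * (n : ℝ) / ((n : ℝ) - 2))

/-- The energy measure `(½|∇u|² + ((n-2)/(2n))|u|^{2n/(n-2)}) dx` on `Ω`. -/
def eMeas (n : ℕ) (Ω : Set (En n)) (u : En n → ℝ) : Measure (En n) :=
  (volume.restrict Ω).withDensity fun y => ENNReal.ofReal (eDen n u y)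

/-- Weak convergence of Radon measures against continuous compactly supported
test functions supported in `Ω`. -/
def WeakConv {n : ℕ} (Ω : Set (En n)) (μs : ℕ → Measure (En n)) (μ : Measure (En n)) : Prop :=
  ∀ φ : En n → ℝ, Continuous φ → HasCompactSupport φ → tsupport φ ⊆ Ω →
    Tendsto (fun i => ∫ y, φ y ∂(μs i)) atTop (𝓝 (∫ y, φ y ∂μ))

/-- Weak convergence in `H¹(Ω)`, tested against continuous compactly supported
functions and vector fields. -/
def WeakH1 {n : ℕ} (Ω : Set (En n)) (us : ℕ → En n → ℝ) (u : En n → ℝ) : Prop :=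
  (∀ φ : En n → ℝ, Continuous φ → HasCompactSupport φ → tsupport φ ⊆ Ω →
    Tendsto (fun i => ∫ y in Ω, us i y * φ y) atTop (𝓝 (∫ y in Ω, u y * φ y))) ∧
  (∀ Φ : En n → En n, Continuous Φ → HasCompactSupport Φ → tsupport Φ ⊆ Ω →
    Tendsto (fun i => ∫ y in Ω, ⟪gradient (us i) y, Φ y⟫) atTop
      (𝓝 (∫ y in Ω, ⟪gradient u y, Φ y⟫)))

/-- `‖u‖_{H¹(Ω)} + ‖u‖_{L^{2n/(n-2)}(Ω)} ≤ Λ`. -/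
def NormBound (n : ℕ) (Ω : Set (En n)) (u : En n → ℝ) (Λ : ℝ) : Prop :=
  (∫ y in Ω, ((u y) ^ 2 + ‖gradient u y‖ ^ 2)) ^ ((1 : ℝ) / 2)
    + (∫ y in Ω, |u y| ^ (2 * (n : ℝ) / ((n : ℝ) - 2))) ^ (((n : ℝ) - 2) / (2 * (n : ℝ))) ≤ Λ

/-- The singular set `Σ = ⋂_{0<r<r₀} {x ∈ Ω : liminf_i E_{uᵢ}(x,r) ≥ ε₀}`. -/
def SingSet (n : ℕ) (Ω : Set (En n)) (us : ℕ → En n → ℝ) (r₀ ε₀ : ℝ) : Set (En n) :=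
  {x ∈ Ω | ∀ r : ℝ, 0 < r → r < r₀ → ε₀ ≤ atTop.liminf fun i => Eu n (us i) x r}



/-- The weight `ψ`. -/
def wpsi {n : ℕ} (y : En n) : ℝ := 4 * max (1 - ‖y‖ ^ 2) 0

/-- The potential `Ψ`. -/
def wPsi {n : ℕ} (y : En n) : ℝ := (max (1 - ‖y‖ ^ 2) 0) ^ 2

lemma wpsi_nonneg {n : ℕ} (y : En n) : 0 ≤ wpsi y := by unfold wpsi; positivity
lemma wPsi_nonneg {n : ℕ} (y : En n) : 0 ≤ wPsi y := by unfold wPsi; positivity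
lemma wpsi_le {n : ℕ} (y : En n) : wpsi y ≤ 4 := by
  unfold wpsi
  have : max (1 - ‖y‖ ^ 2) 0 ≤ 1 := max_le (by nlinarith [sq_nonneg ‖y‖]) (by norm_num)
  linarith
lemma wpsi_cont {n : ℕ} : Continuous (wpsi (n := n)) := by unfold wpsi; fun_prop
lemma wPsi_cont {n : ℕ} : Continuous (wPsi (n := n)) := by unfold wPsi; fun_prop

lemma max_zero_of_not_mem {n : ℕ} {y : En n} (hy : y ∉ closedBall (0 : En n) 1) :
    max (1 - ‖y‖ ^ 2) 0 = 0 := by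
  have : 1 < ‖y‖ := by simpa using hy
  exact max_eq_right (by nlinarith)
lemma wpsi_zero {n : ℕ} {y : En n} (hy : y ∉ closedBall (0 : En n) 1) : wpsi y = 0 := by
  unfold wpsi; rw [max_zero_of_not_mem hy]; simp
lemma wPsi_zero {n : ℕ} {y : En n} (hy : y ∉ closedBall (0 : En n) 1) : wPsi y = 0 := by
  unfold wPsi; rw [max_zero_of_not_mem hy]; simp
lemma wpsi_supp {n : ℕ} : HasCompactSupport (wpsi (n := n)) :=
  HasCompactSupport.intro (isCompact_closedBall 0 1) fun _ => wpsi_zero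
lemma wPsi_supp {n : ℕ} : HasCompactSupport (wPsi (n := n)) :=
  HasCompactSupport.intro (isCompact_closedBall 0 1) fun _ => wPsi_zero

lemma integral_wpsi_pos {n : ℕ} : 0 < ∫ y : En n, wpsi y := by
  refine wpsi_cont.integral_pos_of_hasCompactSupport_nonneg_nonzero wpsi_supp
    (fun y => wpsi_nonneg y) (x := 0) ?_
  simp [wpsi]

lemma hasDerivAt_max_sq (t : ℝ) :
    HasDerivAt (fun t : ℝ => (max t 0) ^ 2) (2 * max t 0) t := by
  rcases lt_trichotomy t 0 with h | h | h
  · have : (fun t : ℝ => (max t 0) ^ 2) =ᶠ[𝓝 t] fun _ => 0 := by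
      filter_upwards [Iio_mem_nhds h] with s hs
      rw [max_eq_right (le_of_lt hs)]; simp
    rw [max_eq_right h.le]
    simpa using (hasDerivAt_const t (0 : ℝ)).congr_of_eventuallyEq this
  · subst h
    simp only [max_self, mul_zero]
    rw [hasDerivAt_iff_isLittleO]
    simp only [sub_zero, max_self, smul_zero]
    have h1 : (fun x : ℝ => max x 0 ^ 2 - 0 ^ 2) =O[𝓝 0] fun x => x ^ 2 := by
      refine Asymptotics.IsBigO.of_bound 1 (Eventually.of_forall fun x => ?_)
      have : |max x 0| ≤ |x| := by
        rcases le_total x 0 with h | h <;> simp [h]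
      simp only [Real.norm_eq_abs, abs_pow, one_mul]
      simpa using this.trans (le_refl _) |> fun h => pow_le_pow_left₀ (abs_nonneg _) h 2
    refine h1.trans_isLittleO ?_
    simpa using (Asymptotics.isLittleO_pow_pow (𝕜 := ℝ) (m := 1) (n := 2) (by norm_num))
  · have : (fun t : ℝ => (max t 0) ^ 2) =ᶠ[𝓝 t] fun t => t ^ 2 := by
      filter_upwards [Ioi_mem_nhds h] with s hs
      rw [max_eq_left (le_of_lt hs)]
    rw [max_eq_left h.le]
    simpa using (hasDerivAt_pow 2 t).congr_of_eventuallyEq this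

lemma hasFDerivAt_wPsi {n : ℕ} (y : En n) :
    HasFDerivAt (wPsi (n := n)) (-(wpsi y) • innerSL ℝ y) y := by
  have h1 : HasFDerivAt (fun y : En n => 1 - ‖y‖ ^ 2) (-((2 : ℝ) • innerSL ℝ y)) y := by
    have := (hasStrictFDerivAt_norm_sq y).hasFDerivAt
    simpa [two_smul] using this.const_sub 1
  have := (hasDerivAt_max_sq (1 - ‖y‖ ^ 2)).comp_hasFDerivAt y h1
  refine this.congr_fderiv ?_
  ext v
  simp [wpsi]; ring

lemma ibp {n : ℕ} (W : En n → ℝ) (hW : ContDiff ℝ 2 W) (x : En n) (t : ℝ) :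
    ∫ y, fderiv ℝ W (x + t • y) y * wpsi y = t * ∫ y, lap W (x + t • y) * wPsi y := by
  have hd : ∀ i : Fin n, ContDiff ℝ 1 (fun y => fderiv ℝ W y (EuclideanSpace.single i 1)) :=
    fun i => (hW.fderiv_right (m := 1) (by norm_num)).clm_apply contDiff_const
  have hdd : ∀ i : Fin n, Continuous (fun y => fderiv ℝ
      (fun y => fderiv ℝ W y (EuclideanSpace.single i 1)) y (EuclideanSpace.single i 1)) :=
    fun i => (((hd i).fderiv_right (m := 0) (by norm_num)).clm_apply contDiff_const).continuous
  have haff : Continuous fun y : En n => x + t • y := by fun_prop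
  have key : ∀ i : Fin n,
      ∫ y : En n, fderiv ℝ W (x + t • y) (EuclideanSpace.single i 1) * (y i * wpsi y)
      = ∫ y, t * (fderiv ℝ (fun y => fderiv ℝ W y (EuclideanSpace.single i 1)) (x + t • y)
          (EuclideanSpace.single i 1) * wPsi y) := by
    intro i
    have hfd : ∀ y : En n, HasFDerivAt
        (fun y => fderiv ℝ W (x + t • y) (EuclideanSpace.single i 1))
        ((fderiv ℝ (fun y => fderiv ℝ W y (EuclideanSpace.single i 1)) (x + t • y)).comp
          (t • ContinuousLinearMap.id ℝ (En n))) y := by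
      intro y
      have h1 : HasFDerivAt (fun y : En n => x + t • y) (t • ContinuousLinearMap.id ℝ (En n)) y :=
        ((hasFDerivAt_id y).const_smul t).const_add x
      exact (((hd i).differentiable (by norm_num)) (x + t • y)).hasFDerivAt.comp y h1
    have e1 : ∀ y : En n, fderiv ℝ (fun y => fderiv ℝ W (x + t • y) (EuclideanSpace.single i 1)) y
        (EuclideanSpace.single i 1) = t * fderiv ℝ
          (fun y => fderiv ℝ W y (EuclideanSpace.single i 1)) (x + t • y)
          (EuclideanSpace.single i 1) := by
      intro y; rw [(hfd y).fderiv]; simp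
    have e2 : ∀ y : En n, fderiv ℝ (wPsi (n := n)) y (EuclideanSpace.single i 1)
        = - (y i * wpsi y) := by
      intro y; rw [(hasFDerivAt_wPsi y).fderiv]
      simp [EuclideanSpace.inner_single_right]; ring
    have hcy : Continuous fun y : En n => y i := by fun_prop
    have := integral_mul_fderiv_eq_neg_fderiv_mul_of_integrable (μ := volume)
      (f := fun y => fderiv ℝ W (x + t • y) (EuclideanSpace.single i 1))
      (g := wPsi (n := n)) (v := EuclideanSpace.single i 1) ?_ ?_ ?_
      (fun y _ => (hfd y).differentiableAt) (fun y _ => (hasFDerivAt_wPsi y).differentiableAt)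
    · simp only [e1, e2, mul_neg, integral_neg, neg_inj] at this
      rw [this]; congr 1; ext y; ring
    · simp only [e1]
      exact ((continuous_const.mul ((hdd i).comp haff)).mul
        wPsi_cont).integrable_of_hasCompactSupport wPsi_supp.mul_left
    · simp only [e2]
      refine Continuous.integrable_of_hasCompactSupport
        (((hd i).continuous.comp haff).mul (hcy.mul wpsi_cont).neg) ?_
      refine HasCompactSupport.intro (isCompact_closedBall (0 : En n) 1) fun y hy => ?_
      simp [wpsi_zero hy]
    · exact (((hd i).continuous.comp haff).mul
        wPsi_cont).integrable_of_hasCompactSupport wPsi_supp.mul_left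
  have hexp : ∀ z y : En n, fderiv ℝ W z y
      = ∑ i, fderiv ℝ W z (EuclideanSpace.single i 1) * y i := by
    intro z y
    have hy : y = ∑ i, y i • (EuclideanSpace.single i (1 : ℝ) : En n) := by
      ext j
      simp [Finset.sum_apply, Pi.single_apply]
    conv_lhs => rw [hy]
    simp [map_sum, mul_comm]
  have e3 : ∀ y : En n, fderiv ℝ W (x + t • y) y * wpsi y
      = ∑ i, fderiv ℝ W (x + t • y) (EuclideanSpace.single i 1) * (y i * wpsi y) := by
    intro y; rw [hexp, Finset.sum_mul]; congr 1; ext i; ring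
  simp only [e3]
  rw [integral_finsetSum, ← integral_const_mul]
  · simp only [key]
    rw [← integral_finsetSum]
    · congr 1; ext y; rw [lap, Finset.sum_mul, Finset.mul_sum]
    · intro i _
      exact (((hdd i).comp haff).mul
        wPsi_cont).integrable_of_hasCompactSupport wPsi_supp.mul_left |>.const_mul t
  · intro i _
    have hcy : Continuous fun y : En n => y i := by fun_prop
    refine Continuous.integrable_of_hasCompactSupport
        (((hd i).continuous.comp haff).mul (hcy.mul wpsi_cont)) ?_
    refine HasCompactSupport.intro (isCompact_closedBall (0 : En n) 1) fun y hy => ?_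
    simp [wpsi_zero hy]

lemma mean_value {n : ℕ} (W : En n → ℝ) (hW : ContDiff ℝ 2 W) (hc : HasCompactSupport W)
    (x : En n) (s K : ℝ) (hs : 0 < s) (hK : ∀ z ∈ closedBall x s, |lap W z| ≤ K) :
    |(∫ y, W (x + s • y) * wpsi y) - W x * ∫ y : En n, wpsi y|
      ≤ s ^ 2 * K * ∫ y : En n, wPsi y := by
  have hK0 : 0 ≤ K := (abs_nonneg _).trans (hK x (mem_closedBall_self hs.le))
  have hcd : Continuous (fderiv ℝ W) := hW.continuous_fderiv (by norm_num)
  obtain ⟨B, hB⟩ := hcd.bounded_above_of_compact_support (hc.fderiv ℝ)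
  have hB0 : 0 ≤ B := (norm_nonneg _).trans (hB 0)
  have hder : ∀ t : ℝ, HasDerivAt (fun t : ℝ => ∫ y, W (x + t • y) * wpsi y)
      (∫ y, fderiv ℝ W (x + t • y) y * wpsi y) t := by
    intro t
    refine (hasDerivAt_integral_of_dominated_loc_of_deriv_le (s := univ)
      (F := fun t y => W (x + t • y) * wpsi y)
      (F' := fun t y => fderiv ℝ W (x + t • y) y * wpsi y)
      (bound := fun y => B * ‖y‖ * wpsi y) univ_mem ?_ ?_ ?_ ?_ ?_ ?_).2
    · refine Eventually.of_forall fun t => Continuous.aestronglyMeasurable ?_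
      exact (hW.continuous.comp (by fun_prop)).mul wpsi_cont
    · exact Continuous.integrable_of_hasCompactSupport
        ((hW.continuous.comp (by fun_prop)).mul wpsi_cont) wpsi_supp.mul_left
    · refine Continuous.aestronglyMeasurable ?_
      exact ((hcd.comp (by fun_prop)).clm_apply continuous_id).mul wpsi_cont
    · refine Eventually.of_forall fun y t _ => ?_
      rw [norm_mul, Real.norm_of_nonneg (wpsi_nonneg y)]
      refine mul_le_mul_of_nonneg_right ?_ (wpsi_nonneg y)
      exact (ContinuousLinearMap.le_opNorm _ _).trans
        (mul_le_mul_of_nonneg_right (hB _) (norm_nonneg _))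
    · exact Continuous.integrable_of_hasCompactSupport
        ((continuous_const.mul continuous_norm).mul wpsi_cont) wpsi_supp.mul_left
    · refine Eventually.of_forall fun y t _ => ?_
      have h1 : HasDerivAt (fun t : ℝ => x + t • y) y t := by
        simpa using ((hasDerivAt_id t).smul_const y).const_add x
      exact (((hW.differentiable (by norm_num)) (x + t • y)).hasFDerivAt.comp_hasDerivAt t
        h1).mul_const _
  have hbd : ∀ t ∈ Ico (0 : ℝ) s, ‖∫ y, fderiv ℝ W (x + t • y) y * wpsi y‖
      ≤ s * (K * ∫ y : En n, wPsi y) := by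
    intro t ht
    rw [ibp W hW x t, norm_mul, Real.norm_of_nonneg ht.1]
    refine mul_le_mul ht.2.le ?_ (norm_nonneg _) hs.le
    rw [← integral_const_mul]
    refine norm_integral_le_of_norm_le ((wPsi_cont.integrable_of_hasCompactSupport
      wPsi_supp).const_mul K) (Eventually.of_forall fun y => ?_)
    by_cases hy : y ∈ closedBall (0 : En n) 1
    · rw [norm_mul, Real.norm_of_nonneg (wPsi_nonneg y)]
      refine mul_le_mul_of_nonneg_right (hK _ ?_) (wPsi_nonneg y)
      have : ‖y‖ ≤ 1 := by simpa using hy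
      simp only [mem_closedBall, dist_self_add_left, norm_smul, Real.norm_of_nonneg ht.1]
      nlinarith [ht.1, ht.2, norm_nonneg y]
    · simp [wPsi_zero hy]
  have := norm_image_sub_le_of_norm_deriv_le_segment' (a := 0) (b := s)
    (fun t _ => (hder t).hasDerivWithinAt) hbd s ⟨hs.le, le_rfl⟩
  simp only [zero_smul, add_zero, integral_const_mul, sub_zero, Real.norm_eq_abs] at this
  calc _ ≤ _ := this
    _ = _ := by ring


lemma mv_local {n : ℕ} (Ω : Set (En n)) (hΩ : IsOpen Ω) (u : En n → ℝ)
    (hu : ContDiffOn ℝ (⊤ : ℕ∞) u Ω) (x : En n) (s K : ℝ) (hs : 0 < s)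
    (hball : closedBall x (2 * s) ⊆ Ω) (hK : ∀ z ∈ closedBall x s, |lap u z| ≤ K) :
    |u x| * (∫ y : En n, wpsi y) ≤ (∫ y, |u (x + s • y)| * wpsi y)
      + s ^ 2 * K * ∫ y : En n, wPsi y := by
  let χ : ContDiffBump x := ⟨3 / 2 * s, 2 * s, by positivity, by linarith⟩
  have hsub : closedBall x s ⊆ ball x (3 / 2 * s) := closedBall_subset_ball (by linarith)
  set W : En n → ℝ := fun z => χ z * u z with hWdef
  have hW : ContDiff ℝ 2 W := by
    rw [contDiff_iff_contDiffAt]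
    intro z
    by_cases hz : z ∈ Ω
    · refine (χ.contDiff.contDiffAt).mul ?_
      exact (hu.contDiffAt (hΩ.mem_nhds hz)).of_le (by exact_mod_cast le_top)
    · have hz' : z ∉ tsupport χ := by
        rw [χ.tsupport_eq]; exact fun h => hz (hball h)
      have : W =ᶠ[𝓝 z] fun _ => 0 := by
        filter_upwards [notMem_tsupport_iff_eventuallyEq.1 hz'] with w hw
        simp [hWdef, hw]
      exact contDiffAt_const.congr_of_eventuallyEq this
  have hWc : HasCompactSupport W := χ.hasCompactSupport.mul_right
  have heq : ∀ z ∈ closedBall x s, W =ᶠ[𝓝 z] u := by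
    intro z hz
    filter_upwards [χ.eventuallyEq_one_of_mem_ball (hsub hz)] with w hw
    simp [hWdef, hw]
  have hlap : ∀ z ∈ closedBall x s, lap W z = lap u z := by
    intro z hz
    unfold lap
    refine Finset.sum_congr rfl fun i _ => ?_
    have : (fun y => fderiv ℝ W y (EuclideanSpace.single i 1)) =ᶠ[𝓝 z]
        fun y => fderiv ℝ u y (EuclideanSpace.single i 1) := by
      filter_upwards [(heq z hz).fderiv (𝕜 := ℝ)] with w hw
      rw [hw]
    rw [this.fderiv_eq]
  have h := mean_value W hW hWc x s K hs (fun z hz => by rw [hlap z hz]; exact hK z hz)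
  have hx : W x = u x := (heq x (mem_closedBall_self hs.le)).eq_of_nhds
  have hI : ∫ y, |u (x + s • y)| * wpsi y = ∫ y, |W (x + s • y)| * wpsi y := by
    congr 1; ext y
    by_cases hy : y ∈ closedBall (0 : En n) 1
    · rw [(heq (x + s • y) ?_).eq_of_nhds]
      have : ‖y‖ ≤ 1 := by simpa using hy
      simp only [mem_closedBall, dist_self_add_left, norm_smul, Real.norm_of_nonneg hs.le]
      nlinarith
    · simp [wpsi_zero hy]
  have h2 : |∫ y, W (x + s • y) * wpsi y| ≤ ∫ y, |W (x + s • y)| * wpsi y := by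
    refine (abs_integral_le_integral_abs).trans (le_of_eq ?_)
    congr 1; ext y
    rw [abs_mul, abs_of_nonneg (wpsi_nonneg y)]
  have h3 : |u x| * (∫ y : En n, wpsi y) = |W x * ∫ y : En n, wpsi y| := by
    rw [abs_mul, abs_of_pos integral_wpsi_pos, hx]
  rw [h3, hI]
  have h4 := abs_sub_abs_le_abs_sub (W x * ∫ y : En n, wpsi y) (∫ y, W (x + s • y) * wpsi y)
  rw [abs_sub_comm] at h4
  linarith

lemma young_aux (a v p : ℝ) (ha : 0 < a) (hv : 0 ≤ v) (hp : 1 ≤ p) :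
    v ≤ a + a ^ (1 - p) * v ^ p := by
  rcases le_total v a with h | h
  · have : 0 ≤ a ^ (1 - p) * v ^ p := by positivity
    linarith
  · have hv0 : 0 < v := ha.trans_le h
    have h1 : v ^ (1 - p) ≤ a ^ (1 - p) :=
      Real.rpow_le_rpow_of_nonpos ha h (by linarith)
    have h2 : v ^ (1 - p) * v ^ p = v := by
      rw [← Real.rpow_add hv0]; simp
    have h3 : v ^ (1 - p) * v ^ p ≤ a ^ (1 - p) * v ^ p :=
      mul_le_mul_of_nonneg_right h1 (by positivity)
    linarith

lemma mv_energy {n : ℕ} (u : En n → ℝ) (x : En n) (s a p E : ℝ) (hs : 0 < s)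
    (ha : 0 < a) (hp : 1 ≤ p)
    (hc : ContinuousOn u (closedBall x s))
    (hE : ∫ z in closedBall x s, |u z| ^ p ≤ E) :
    (∫ y, |u (x + s • y)| * wpsi y)
      ≤ a * (∫ y : En n, wpsi y) + 4 * a ^ (1 - p) * (s ^ n)⁻¹ * E := by
  have hp0 : 0 ≤ p := by linarith
  set g : En n → ℝ := (closedBall x s).indicator (fun z => |u z| ^ p) with hg
  have hgi : Integrable g := by
    rw [hg, integrable_indicator_iff measurableSet_closedBall]
    exact (hc.abs.rpow_const (fun _ _ => Or.inr hp0)).integrableOn_compact (isCompact_closedBall x s)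
  have hgi2 : Integrable (fun y => g (x + s • y)) :=
    (hgi.comp_add_left x).comp_smul hs.ne'
  have hgint : ∫ y, g (x + s • y) = (s ^ n)⁻¹ * ∫ z in closedBall x s, |u z| ^ p := by
    rw [Measure.integral_comp_smul volume (fun y => g (x + y)) s, integral_add_left_eq_self,
      hg, integral_indicator measurableSet_closedBall, smul_eq_mul, finrank_euclideanSpace_fin,
      abs_of_pos (by positivity)]
  have hwi : Integrable (wpsi (n := n)) := wpsi_cont.integrable_of_hasCompactSupport wpsi_supp
  have hpos : 0 ≤ a ^ (1 - p) := by positivity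
  calc (∫ y, |u (x + s • y)| * wpsi y)
      ≤ ∫ y, (a * wpsi y + 4 * a ^ (1 - p) * g (x + s • y)) := by
        refine integral_mono_of_nonneg (Eventually.of_forall fun y => ?_)
          ((hwi.const_mul a).add (hgi2.const_mul _)) (Eventually.of_forall fun y => ?_)
        · exact mul_nonneg (abs_nonneg _) (wpsi_nonneg y)
        · by_cases hy : y ∈ closedBall (0 : En n) 1
          · have hm : x + s • y ∈ closedBall x s := by
              have : ‖y‖ ≤ 1 := by simpa using hy
              simp only [mem_closedBall, dist_self_add_left, norm_smul, Real.norm_of_nonneg hs.le]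
              nlinarith
            have hgy : g (x + s • y) = |u (x + s • y)| ^ p := by simp only [hg, indicator_of_mem hm]
            simp only [hgy]
            have h1 := young_aux a |u (x + s • y)| p ha (abs_nonneg _) hp
            have h2 : 0 ≤ a ^ (1 - p) * |u (x + s • y)| ^ p := by positivity
            have h3 := mul_le_mul_of_nonneg_right h1 (wpsi_nonneg y)
            have h4 := mul_le_mul_of_nonneg_left (wpsi_le y) h2
            nlinarith
          · have : 0 ≤ g (x + s • y) := indicator_nonneg (fun z _ => by positivity) _
            simp only [wpsi_zero hy, mul_zero, zero_add]
            positivity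
    _ = a * (∫ y : En n, wpsi y) + 4 * a ^ (1 - p) * ((s ^ n)⁻¹ *
          ∫ z in closedBall x s, |u z| ^ p) := by
        rw [integral_add (hwi.const_mul a) (hgi2.const_mul _), integral_const_mul,
          integral_const_mul, hgint]
    _ ≤ _ := by
        have : 0 ≤ 4 * a ^ (1 - p) * (s ^ n)⁻¹ := by positivity
        have := mul_le_mul_of_nonneg_left hE this
        linarith

/-- Scaling identity for the Laplacian term. -/
lemma scale_lap (q M l : ℝ) (hq : 0 < q) (hM : 0 < M) :
    (l * M ^ (-1 / q)) ^ 2 * ((2 ^ q * M) * (2 ^ q * M) ^ (2 / q)) = l ^ 2 * 2 ^ (q + 2) * M := by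
  have e1 : (M ^ (-1 / q)) ^ 2 = M ^ (-2 / q) := by
    rw [← Real.rpow_natCast, ← Real.rpow_mul hM.le]; congr 1; push_cast; ring
  have e2 : (2 ^ q * M : ℝ) ^ (2 / q) = 2 ^ (2 : ℝ) * M ^ (2 / q) := by
    rw [Real.mul_rpow (by positivity) hM.le, ← Real.rpow_mul (by norm_num)]
    congr 2; field_simp
  have e3 : M ^ (-2 / q) * M ^ (2 / q) = 1 := by
    rw [← Real.rpow_add hM, show -2 / q + 2 / q = 0 by ring, Real.rpow_zero]
  rw [mul_pow, e1, e2, Real.rpow_add (by norm_num)]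
  linear_combination l ^ 2 * (2 ^ q * 2 ^ (2 : ℝ)) * M * e3

/-- Scaling identity for the energy term. -/
lemma scale_energy (n : ℕ) (q p M l : ℝ) (hM : 0 < M) (hl : 0 < l) (hp : p = n / q) :
    4 * (M / 4) ^ (1 - p) * ((l * M ^ (-1 / q)) ^ n)⁻¹ = 4 ^ p * (l ^ n)⁻¹ * M := by
  have e1 : ((M ^ (-1 / q)) ^ n)⁻¹ = M ^ p := by
    rw [← Real.rpow_natCast, ← Real.rpow_mul hM.le, ← Real.rpow_neg hM.le, hp]; congr 1; ring
  have e2 : (M / 4) ^ (1 - p) = M ^ (1 - p) * (4 ^ p / 4) := by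
    rw [Real.div_rpow hM.le (by norm_num), Real.rpow_sub (by norm_num : (0:ℝ) < 4), Real.rpow_one]
    field_simp
  have e3 : M ^ (1 - p) * M ^ p = M := by
    rw [← Real.rpow_add hM]; simp
  rw [mul_pow, mul_inv, e1, e2]
  linear_combination 4 ^ p * (l ^ n)⁻¹ * e3

lemma core {n : ℕ} (hn : 3 ≤ n) (q p l ε : ℝ) (hq : q = ((n : ℝ) - 2) / 2)
    (hp : p = 2 * (n : ℝ) / ((n : ℝ) - 2)) (hl : 0 < l) (hl2 : l ≤ 1 / 2)
    (hl3 : l ^ 2 * 2 ^ (q + 2) * (∫ y : En n, wPsi y) ≤ (∫ y : En n, wpsi y) / 4)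
    (hε : 4 ^ p * (l ^ n)⁻¹ * ε ≤ (∫ y : En n, wpsi y) / 4)
    (Ω : Set (En n)) (hΩ : IsOpen Ω) (u : En n → ℝ) (hu : IsYamabeSol n Ω u)
    (x₀ : En n) (r : ℝ) (hr : 0 < r) (hball : closedBall x₀ r ⊆ Ω)
    (hE : ∫ y in closedBall x₀ r, |u y| ^ p ≤ ε) :
    ∀ y ∈ closedBall x₀ (r / 2), (r / 2 - dist y x₀) ^ q * |u y| ≤ 1 := by
  have hn' : (3 : ℝ) ≤ n := by exact_mod_cast hn
  have hq0 : 0 < q := by rw [hq]; linarith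
  have hpq : p = n / q := by rw [hp, hq]; field_simp
  have hp1 : 1 ≤ p := by rw [hp, le_div_iff₀ (by linarith)]; linarith
  have h4q : (4 : ℝ) / ((n : ℝ) - 2) = 2 / q := by
    rw [hq]; have : (n : ℝ) - 2 ≠ 0 := by linarith
    field_simp; norm_num
  have huc : ContinuousOn u (closedBall x₀ r) := hu.1.continuousOn.mono hball
  have hsub : closedBall x₀ (r / 2) ⊆ closedBall x₀ r := closedBall_subset_closedBall (by linarith)
  have hfc : ContinuousOn (fun y => (r / 2 - dist y x₀) ^ q * |u y|) (closedBall x₀ (r / 2)) := by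
    refine ContinuousOn.mul ?_ (huc.mono hsub).abs
    exact ContinuousOn.rpow_const (by fun_prop) fun _ _ => Or.inr hq0.le
  obtain ⟨x, hx, hmax⟩ := (isCompact_closedBall x₀ (r / 2)).exists_isMaxOn
    ⟨x₀, mem_closedBall_self (by positivity)⟩ hfc
  intro y hy
  refine (hmax hy).trans ?_
  by_contra hA
  push Not at hA
  set σ := r / 2 - dist x x₀ with hσ
  set M := |u x| with hMdef
  have hσ0' : 0 ≤ σ := by
    have : dist x x₀ ≤ r / 2 := hx
    linarith
  have hM : 0 < M := by
    rcases (abs_nonneg (u x)).lt_or_eq with h | h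
    · exact h
    · rw [hMdef, ← h] at hA; simp at hA; linarith
  have hσ0 : 0 < σ := by
    rcases hσ0'.lt_or_eq with h | h
    · exact h
    · rw [← h, Real.zero_rpow hq0.ne'] at hA; simp at hA; linarith
  set s₀ := M ^ (-1 / q) with hs₀
  have hs₀0 : 0 < s₀ := by positivity
  have hs₀σ : s₀ < σ := by
    rw [← Real.rpow_lt_rpow_iff hs₀0.le hσ0' hq0, hs₀, ← Real.rpow_mul hM.le]
    rw [show -1 / q * q = -1 by field_simp, Real.rpow_neg_one]
    rwa [inv_lt_iff_one_lt_mul₀ hM]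
  set s := l * s₀ with hs
  have hs0 : 0 < s := by positivity
  have hsσ : 2 * s ≤ σ := by rw [hs]; nlinarith
  have hb2 : closedBall x (2 * s) ⊆ closedBall x₀ r := by
    refine closedBall_subset_closedBall' ?_
    linarith
  have hb1 : closedBall x s ⊆ closedBall x₀ r :=
    (closedBall_subset_closedBall (by linarith)).trans hb2
  have hub : ∀ z ∈ closedBall x s, |u z| ≤ 2 ^ q * M := by
    intro z hz
    have hz1 : dist z x ≤ s := hz
    have hz2 : dist z x₀ ≤ dist z x + dist x x₀ := dist_triangle _ _ _
    have hz3 : z ∈ closedBall x₀ (r / 2) := by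
      rw [mem_closedBall]; linarith
    have h1 : (r / 2 - dist z x₀) ^ q * |u z| ≤ σ ^ q * M := hmax hz3
    have h2 : (σ / 2) ^ q ≤ (r / 2 - dist z x₀) ^ q :=
      Real.rpow_le_rpow (by positivity) (by linarith) hq0.le
    have h3 := (mul_le_mul_of_nonneg_right h2 (abs_nonneg (u z))).trans h1
    rw [Real.div_rpow hσ0.le (by norm_num)] at h3
    have h5 : 0 < σ ^ q := by positivity
    have h6 : (0 : ℝ) < 2 ^ q := by positivity
    have h7 : σ ^ q * |u z| ≤ σ ^ q * (2 ^ q * M) := by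
      have := mul_le_mul_of_nonneg_left h3 h6.le
      calc σ ^ q * |u z| = 2 ^ q * (σ ^ q / 2 ^ q * |u z|) := by field_simp
        _ ≤ _ := this
        _ = _ := by ring
    exact le_of_mul_le_mul_left h7 h5
  have hK : ∀ z ∈ closedBall x s, |lap u z| ≤ (2 ^ q * M) * (2 ^ q * M) ^ (2 / q) := by
    intro z hz
    have := hu.2 z (hball (hb1 hz))
    rw [← abs_neg, this, h4q, abs_mul, abs_of_nonneg (Real.rpow_nonneg (abs_nonneg _) _)]
    have h1 := hub z hz
    gcongr
  have hEx : ∫ z in closedBall x s, |u z| ^ p ≤ ε := by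
    refine le_trans ?_ hE
    refine setIntegral_mono_set ?_ (Eventually.of_forall fun z => by positivity) hb1.eventuallyLE
    exact (huc.abs.rpow_const (fun _ _ => Or.inr (by linarith))).integrableOn_compact
      (isCompact_closedBall _ _)
  have m1 := mv_local Ω hΩ u hu.1 x s _ hs0 (hb2.trans hball) hK
  have m2 := mv_energy u x s (M / 4) p ε hs0 (by positivity) hp1 (huc.mono hb1) hEx
  rw [scale_energy n q p M l hM hl hpq] at m2
  rw [scale_lap q M l hq0 hM] at m1
  have hI := integral_wpsi_pos (n := n)
  have k1 := mul_le_mul_of_nonneg_left hl3 hM.le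
  have k2 := mul_le_mul_of_nonneg_left hε hM.le
  have k3 := mul_pos hM hI
  nlinarith

/-- ε-regularity. There exist `ε₀ > 0` and `C > 0` depending only on `n`
such that any smooth solution with energy at most `ε₀` on a closed ball `B(x₀,r) ⊆ Ω`
satisfies `sup_{B(x₀,r/4)} |u| ≤ C r^{-(n-2)/2}`. -/
theorem epsilon_regularity {n : ℕ} (hn : 3 ≤ n) :
    ∃ ε₀ > (0 : ℝ), ∃ C > (0 : ℝ),
      ∀ (Ω : Set (En n)), IsOpen Ω →
      ∀ u : En n → ℝ, IsYamabeSol n Ω u →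
      ∀ (x₀ : En n) (r : ℝ), 0 < r → closedBall x₀ r ⊆ Ω →
      (∫ y in closedBall x₀ r,
          (‖gradient u y‖ ^ 2 + |u y| ^ (2 * (n : ℝ) / ((n : ℝ) - 2)))) ≤ ε₀ →
      ∀ y ∈ ball x₀ (r / 4), |u y| ≤ C * r ^ (-((n : ℝ) - 2) / 2) := by
  have hn' : (3 : ℝ) ≤ n := by exact_mod_cast hn
  obtain ⟨q, hq⟩ : ∃ q : ℝ, q = ((n : ℝ) - 2) / 2 := ⟨_, rfl⟩
  obtain ⟨p, hp⟩ : ∃ p : ℝ, p = 2 * (n : ℝ) / ((n : ℝ) - 2) := ⟨_, rfl⟩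
  have hq0 : 0 < q := by rw [hq]; linarith
  have hp0 : 0 ≤ p := by rw [hp]; exact div_nonneg (by linarith) (by linarith)
  have hI := integral_wpsi_pos (n := n)
  have hJ : 0 ≤ ∫ y : En n, wPsi y := integral_nonneg wPsi_nonneg
  obtain ⟨D, hD⟩ : ∃ D : ℝ, D = 2 ^ (q + 2) * (∫ y : En n, wPsi y) := ⟨_, rfl⟩
  have hD0 : 0 ≤ D := by rw [hD]; positivity
  obtain ⟨l, hl⟩ : ∃ l : ℝ, l = min (1 / 2) ((∫ y : En n, wpsi y) / (4 * (D + 1))) := ⟨_, rfl⟩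
  have hl0 : 0 < l := by rw [hl]; positivity
  have hl2 : l ≤ 1 / 2 := by rw [hl]; exact min_le_left _ _
  have hl3 : l ^ 2 * 2 ^ (q + 2) * (∫ y : En n, wPsi y) ≤ (∫ y : En n, wpsi y) / 4 := by
    have h1 : l ≤ (∫ y : En n, wpsi y) / (4 * (D + 1)) := by rw [hl]; exact min_le_right _ _
    rw [le_div_iff₀ (by positivity)] at h1
    rw [mul_assoc, ← hD]
    nlinarith [mul_nonneg hl0.le hD0, mul_nonneg (mul_nonneg hl0.le hD0) (by linarith : 0 ≤ 1 - l)]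
  refine ⟨(∫ y : En n, wpsi y) / 4 * l ^ n / 4 ^ p, by positivity, 4 ^ q, by positivity, ?_⟩
  intro Ω hΩ u hu x₀ r hr hball hE y hy
  rw [← hp] at hE
  have huc : ContinuousOn u (closedBall x₀ r) := hu.1.continuousOn.mono hball
  have hgc : ContinuousOn (fun y => ‖gradient u y‖ ^ 2) (closedBall x₀ r) := by
    have h1 : ContinuousOn (fderiv ℝ u) Ω := hu.1.continuousOn_fderiv_of_isOpen hΩ (by simp)
    have h2 : ∀ y, ‖gradient u y‖ = ‖fderiv ℝ u y‖ := fun y => by simp [gradient]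
    simp only [h2]
    exact (h1.mono hball).norm.pow 2
  have hpc : ContinuousOn (fun y => |u y| ^ p) (closedBall x₀ r) :=
    huc.abs.rpow_const fun _ _ => Or.inr hp0
  have hE' : ∫ y in closedBall x₀ r, |u y| ^ p ≤ (∫ y : En n, wpsi y) / 4 * l ^ n / 4 ^ p := by
    refine le_trans (setIntegral_mono_on (hpc.integrableOn_compact (isCompact_closedBall _ _))
      ((hgc.add hpc).integrableOn_compact (isCompact_closedBall _ _))
      measurableSet_closedBall fun z _ => ?_) hE
    have : 0 ≤ ‖gradient u z‖ ^ 2 := by positivity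
    simp only [Pi.add_apply]
    linarith
  have hyd : dist y x₀ < r / 4 := hy
  have h := core hn q p l _ hq hp hl0 hl2 hl3 (le_of_eq (by field_simp)) Ω hΩ u hu x₀ r hr hball hE'
    y (by rw [mem_closedBall]; linarith)
  have h1 : (r / 4) ^ q ≤ (r / 2 - dist y x₀) ^ q :=
    Real.rpow_le_rpow (by positivity) (by linarith) hq0.le
  have h2 := (mul_le_mul_of_nonneg_right h1 (abs_nonneg (u y))).trans h
  rw [show -((n : ℝ) - 2) / 2 = -q by rw [hq]; ring, Real.rpow_neg hr.le]
  rw [Real.div_rpow hr.le (by norm_num)] at h2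
  have h5 : 0 < r ^ q := by positivity
  have h6 : (0 : ℝ) < 4 ^ q := by positivity
  rw [← div_eq_mul_inv, le_div_iff₀ h5]
  calc |u y| * r ^ q = 4 ^ q * (r ^ q / 4 ^ q * |u y|) := by field_simp
    _ ≤ 4 ^ q * 1 := mul_le_mul_of_nonneg_left h2 h6.le
    _ = _ := mul_one _

end
end

section
/- Let n ≥ 3, let Ω ⊆ ℝⁿ be open, and let u be a smooth solution of −Δu = u|u|^{4/(n−2)} on Ω. There exists a constant C > 0, depending only on n, such that for every x and every r > 0 with the closed ball B(x,r) contained in Ω: ∫_{B(x, r/2)} ( |∇u|² + |u|^{2n/(n−2)} ) dy ≤ C · E_u(x,r). -/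
open MeasureTheory Metric Filter Topology Set
open scoped ENNReal NNReal RealInnerProductSpace

noncomputable section

/-- unit sphere -/
abbrev Sph (n : ℕ) := sphere (0 : En n) 1

/-- surface measure -/
abbrev sig (n : ℕ) : Measure (Sph n) := (volume : Measure (En n)).toSphere

/-- spherical integral at radius s -/
def Av {n : ℕ} (f : En n → ℝ) (s : ℝ) : ℝ := ∫ θ : Sph n, f (s • (θ : En n)) ∂(sig n)

/-- ball integral in polar form -/
def Ib {n : ℕ} (f : En n → ℝ) (r : ℝ) : ℝ := ∫ s in (0:ℝ)..r, s ^ (n - 1) * Av f s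

lemma polar_integral {n : ℕ} (hn : 1 ≤ n) (f : En n → ℝ) (hf : Integrable f) :
    ∫ x, f x = ∫ s in Ioi (0:ℝ), s ^ (n - 1) * Av f s := by
  have : Nonempty (Fin n) := ⟨⟨0, hn⟩⟩
  have : Nontrivial (En n) := inferInstance
  have hd : Module.finrank ℝ (En n) = n := by simp
  have key := (volume : Measure (En n)).measurePreserving_homeomorphUnitSphereProd
  have hme : MeasurableEmbedding (homeomorphUnitSphereProd (En n)) :=
    Homeomorph.measurableEmbedding _
  have hms : MeasurableSet ({0}ᶜ : Set (En n)) := (measurableSet_singleton _).compl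
  set g : Sph n × Ioi (0:ℝ) → ℝ := fun p => f ((p.2 : ℝ) • (p.1 : En n)) with hg
  have hcomp : ∀ x : ({0}ᶜ : Set (En n)), g (homeomorphUnitSphereProd (En n) x) = f x := by
    intro x
    have hx : ‖(x : En n)‖ ≠ 0 := norm_ne_zero_iff.2 x.2
    simp [hg, homeomorphUnitSphereProd, smul_smul, hx]
  have hInteg : Integrable g ((volume : Measure (En n)).toSphere.prod
      (.volumeIoiPow (Module.finrank ℝ (En n) - 1))) := by
    rw [← key.integrable_comp_emb hme]
    have : (g ∘ (homeomorphUnitSphereProd (En n))) = f ∘ Subtype.val := funext hcomp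
    rw [this, ← integrableOn_iff_comap_subtypeVal hms]
    exact hf.integrableOn
  calc ∫ x, f x = ∫ x : ({(0)}ᶜ : Set (En n)), f x.1 ∂(volume.comap Subtype.val) := by
        rw [integral_subtype_comap hms fun x ↦ f x, restrict_compl_singleton]
    _ = ∫ p, g p ∂((volume : Measure (En n)).toSphere.prod
          (.volumeIoiPow (Module.finrank ℝ (En n) - 1))) := by
        rw [← key.integral_comp hme]
        exact integral_congr_ae (.of_forall fun x => (hcomp x).symm)
    _ = ∫ s : Ioi (0:ℝ), Av f s ∂(.volumeIoiPow (Module.finrank ℝ (En n) - 1)) := by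
        rw [integral_prod_symm _ hInteg]; rfl
    _ = _ := by
        simp only [Measure.volumeIoiPow, ENNReal.ofReal]
        rw [integral_withDensity_eq_integral_smul,
          integral_subtype_comap measurableSet_Ioi
            fun a ↦ Real.toNNReal (a ^ (Module.finrank ℝ (En n) - 1)) • Av f a,
          setIntegral_congr_fun measurableSet_Ioi fun x hx ↦ ?_]
        · rw [NNReal.smul_def, Real.coe_toNNReal _ (pow_nonneg hx.out.le _), hd]; rfl
        · exact (measurable_subtype_coe.pow_const _).real_toNNReal

lemma Av_continuous {n : ℕ} {f : En n → ℝ} (hf : Continuous f) : Continuous (Av f) := by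
  have := continuous_parametric_integral_of_continuous (μ := sig n) (s := univ)
    (f := fun (s : ℝ) (θ : Sph n) => f (s • (θ : En n)))
    (by unfold Function.uncurry; fun_prop) isCompact_univ
  simp only [setIntegral_univ] at this
  exact this

lemma sph_integrable {n : ℕ} {f : En n → ℝ} (hf : Continuous f) (s : ℝ) :
    Integrable (fun θ : Sph n => f (s • (θ : En n))) (sig n) := by
  have h : Continuous (fun θ : Sph n => f (s • (θ : En n))) := by fun_prop
  exact h.integrable_of_hasCompactSupport (HasCompactSupport.of_compactSpace _)

lemma Av_congr {n : ℕ} {f g : En n → ℝ} {s R : ℝ} (hs : 0 ≤ s) (hsR : s < R)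
    (h : ∀ x, ‖x‖ < R → f x = g x) : Av f s = Av g s := by
  unfold Av
  congr 1; ext θ
  apply h
  have : ‖(θ : En n)‖ = 1 := by simpa using θ.2
  rw [norm_smul, this]; simpa [abs_of_nonneg hs] using hsR

lemma Ib_congr {n : ℕ} {f g : En n → ℝ} {r R : ℝ} (hs : 0 ≤ r) (hsR : r < R)
    (h : ∀ x, ‖x‖ < R → f x = g x) : Ib f r = Ib g r := by
  unfold Ib
  apply intervalIntegral.integral_congr
  intro s hs'
  rw [uIcc_of_le hs] at hs'
  simp only
  rw [Av_congr hs'.1 (hs'.2.trans_lt hsR) h]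

lemma Ib_hasDerivAt {n : ℕ} {f : En n → ℝ} (hf : Continuous f) (r : ℝ) :
    HasDerivAt (Ib f) (r ^ (n-1) * Av f r) r := by
  have hc : Continuous fun s : ℝ => s ^ (n-1) * Av f s := by
    have := Av_continuous hf; fun_prop
  exact intervalIntegral.integral_hasDerivAt_right (hc.intervalIntegrable _ _)
    (hc.stronglyMeasurableAtFilter _ _) hc.continuousAt

lemma Ib_continuous {n : ℕ} {f : En n → ℝ} (hf : Continuous f) : Continuous (Ib f) :=
  continuous_iff_continuousAt.2 fun r => (Ib_hasDerivAt hf r).continuousAt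

lemma closedBall_integral {n : ℕ} (hn : 1 ≤ n) {f : En n → ℝ} (hf : Continuous f) {r : ℝ}
    (hr : 0 < r) : ∫ x in closedBall (0 : En n) r, f x = Ib f r := by
  rw [← integral_indicator measurableSet_closedBall, polar_integral hn]
  · unfold Ib
    rw [intervalIntegral.integral_of_le hr.le, ← integral_indicator measurableSet_Ioi,
      ← integral_indicator measurableSet_Ioc]
    congr 1; ext s
    by_cases h0 : 0 < s
    · rw [indicator_of_mem (by exact h0)]
      by_cases h1 : s ≤ r
      · rw [indicator_of_mem (by exact ⟨h0, h1⟩)]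
        congr 1; unfold Av; congr 1; ext θ
        rw [indicator_of_mem]
        have : ‖(θ : En n)‖ = 1 := by simpa using θ.2
        simp [norm_smul, abs_of_pos h0, h1]
      · rw [indicator_of_notMem (by simp [h1])]
        have : Av ((closedBall (0 : En n) r).indicator f) s = 0 := by
          unfold Av
          rw [integral_eq_zero_of_ae]
          refine .of_forall fun θ => ?_
          simp only [Pi.zero_apply]
          rw [indicator_of_notMem]
          have : ‖(θ : En n)‖ = 1 := by simpa using θ.2
          simp [norm_smul, abs_of_pos h0]; linarith
        simp [this]
    · rw [indicator_of_notMem (by exact h0), indicator_of_notMem (by simp [h0])]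
  · rw [integrable_indicator_iff measurableSet_closedBall]
    exact hf.continuousOn.integrableOn_compact (isCompact_closedBall _ _)

lemma radial_hasFDerivAt {n : ℕ} {χ : ℝ → ℝ} {Ψ : ℝ → ℝ} {δ : ℝ} (hδ : 0 < δ)
    (hχ : ∀ s < δ, χ s = 0) (hΨ : ∀ s, HasDerivAt Ψ (s * χ s) s) (x : En n) :
    HasFDerivAt (fun y : En n => Ψ ‖y‖) (χ ‖x‖ • innerSL ℝ x) x := by
  by_cases hx : x = 0
  · subst hx
    have hz : χ ‖(0 : En n)‖ • innerSL ℝ (0 : En n) = 0 := by simp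
    rw [hz]
    have hconst : ∀ s ∈ Iio δ, Ψ s = Ψ 0 := by
      intro s hs
      have hd : ∀ t ∈ Iio δ, HasDerivWithinAt Ψ 0 (Iio δ) t := by
        intro t ht
        have := (hΨ t).hasDerivWithinAt (s := Iio δ)
        rwa [hχ t ht, mul_zero] at this
      exact (convex_Iio δ).is_const_of_fderivWithin_eq_zero (𝕜 := ℝ)
        (fun t ht => (hd t ht).differentiableWithinAt)
        (fun t ht => by
          have := (hd t ht).hasFDerivWithinAt.fderivWithin (isOpen_Iio.uniqueDiffWithinAt ht)
          rw [this]; ext; simp) hs hδ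
    have : (fun y : En n => Ψ ‖y‖) =ᶠ[𝓝 0] fun _ => Ψ 0 := by
      filter_upwards [ball_mem_nhds (0 : En n) hδ] with y hy
      exact hconst _ (by simpa using hy)
    exact (hasFDerivAt_const (Ψ 0) (0 : En n)).congr_of_eventuallyEq this
  · have hn : ‖x‖ ≠ 0 := norm_ne_zero_iff.2 hx
    have h1 : HasFDerivAt (fun y : En n => ‖y‖) (‖x‖⁻¹ • innerSL ℝ x) x := by
      have h2 := (hasStrictFDerivAt_norm_sq x).hasFDerivAt.sqrt (by positivity)
      have h3 : (fun y : En n => √(‖y‖ ^ 2)) = fun y => ‖y‖ := by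
        ext y; exact Real.sqrt_sq (norm_nonneg _)
      simp only [h3, Real.sqrt_sq (norm_nonneg _)] at h2
      have h5 : ‖x‖⁻¹ • innerSL ℝ x = (1 / (2 * ‖x‖)) • (2 : ℕ) • innerSL ℝ x := by
        ext v
        simp
        field_simp
      rw [h5]; exact h2
    have h4 := (hΨ ‖x‖).comp_hasFDerivAt x h1
    have h5 : χ ‖x‖ • innerSL ℝ x = (‖x‖ * χ ‖x‖) • ‖x‖⁻¹ • innerSL ℝ x := by
      rw [smul_smul]; congr 1; field_simp
    rw [h5]; exact h4

lemma divergence_ball {n : ℕ} (hn : 1 ≤ n) {f : En n → ℝ} (hf : ContDiff ℝ 1 f) (e : En n)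
    {r : ℝ} (hr : 0 < r) :
    r * Ib (fun x => fderiv ℝ f x e) r = r ^ (n-1) * Av (fun x => f x * ⟪x, e⟫) r := by
  set f' : En n → ℝ := fun x => fderiv ℝ f x e with hf'
  have hcf : Continuous f := hf.continuous
  have hcf' : Continuous f' := by
    have := hf.continuous_fderiv one_ne_zero
    fun_prop
  set F : ℝ → ℝ := fun r => r * Ib f' r - r ^ (n-1) * Av (fun x => f x * ⟪x, e⟫) r with hF
  have hcg : Continuous (fun x : En n => f x * ⟪x, e⟫) := by fun_prop
  have hcF : Continuous F := by
    have := Ib_continuous hcf'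
    have := Av_continuous hcg
    fun_prop
  have main : ∀ᵐ s ∂(volume : Measure ℝ), s ∈ Ioi (0:ℝ) → F s = 0 := by
    refine isOpen_Ioi.ae_eq_zero_of_integral_contDiff_smul_eq_zero
      (hcF.locallyIntegrable.locallyIntegrableOn _) ?_
    intro χ hχ hχc hχs
    have hcχ : Continuous χ := hχ.continuous
    -- bounds of support
    obtain ⟨δ, hδ, hχδ⟩ : ∃ δ > 0, ∀ s < δ, χ s = 0 := by
      by_cases hne : (tsupport χ).Nonempty
      · obtain ⟨m, hm, hmin⟩ := hχc.isCompact.exists_isLeast hne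
        refine ⟨m, hχs hm, fun s hs => ?_⟩
        by_contra h
        exact absurd (hmin (subset_tsupport _ h)) (not_le.2 hs)
      · refine ⟨1, one_pos, fun s _ => ?_⟩
        by_contra h
        exact hne ⟨s, subset_tsupport _ h⟩
    obtain ⟨M, hM, hχM⟩ : ∃ M > 0, ∀ s > M, χ s = 0 := by
      obtain ⟨B, hB⟩ := hχc.isCompact.bddAbove
      refine ⟨max B 1, by positivity, fun s hs => ?_⟩
      by_contra h
      exact absurd (hB (subset_tsupport _ h)) (not_le.2 ((le_max_left _ _).trans_lt hs))
    set Ψ : ℝ → ℝ := fun s => ∫ t in M..s, t * χ t with hΨdef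
    have hcc : Continuous fun t : ℝ => t * χ t := by fun_prop
    have hΨ : ∀ s, HasDerivAt Ψ (s * χ s) s := fun s =>
      intervalIntegral.integral_hasDerivAt_right (hcc.intervalIntegrable _ _)
        (hcc.stronglyMeasurableAtFilter _ _) hcc.continuousAt
    have hΨM : ∀ s ≥ M, Ψ s = 0 := by
      intro s hs
      simp only [hΨdef]
      rw [intervalIntegral.integral_of_le hs]
      rw [setIntegral_congr_fun measurableSet_Ioc (g := fun _ => 0)]
      · simp
      · intro t ht
        simp [hχM t ht.1]
    have hcΨ : Continuous Ψ := continuous_iff_continuousAt.2 fun s => (hΨ s).continuousAt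
    have hφ : ∀ x, HasFDerivAt (fun y : En n => Ψ ‖y‖) (χ ‖x‖ • innerSL ℝ x) x :=
      radial_hasFDerivAt hδ hχδ hΨ
    have hφ' : ∀ x, fderiv ℝ (fun y : En n => Ψ ‖y‖) x e = χ ‖x‖ * ⟪x, e⟫ := by
      intro x; rw [(hφ x).fderiv]; simp
    have supp : ∀ (g : En n → ℝ), Continuous g → (∀ x, M < ‖x‖ → g x = 0) → Integrable g := by
      intro g hg h0
      refine hg.integrable_of_hasCompactSupport
        (HasCompactSupport.intro (isCompact_closedBall (0 : En n) M) ?_)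
      intro x hx
      exact h0 x (by simpa using hx)
    have i1 : Integrable (fun x : En n => χ ‖x‖ * ⟪x, e⟫ * f x) :=
      supp _ (by fun_prop) (fun x hx => by simp [hχM _ hx])
    have i2 : Integrable (fun x : En n => Ψ ‖x‖ * f' x) :=
      supp _ (by fun_prop) (fun x hx => by simp [hΨM _ hx.le])
    have i3 : Integrable (fun x : En n => Ψ ‖x‖ * f x) :=
      supp _ (by fun_prop) (fun x hx => by simp [hΨM _ hx.le])
    have parts := integral_mul_fderiv_eq_neg_fderiv_mul_of_integrable
      (μ := (volume : Measure (En n))) (f := fun y : En n => Ψ ‖y‖) (g := f) (v := e)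
      (by simpa only [hφ'] using i1) i2 i3 (fun x _ => (hφ x).differentiableAt)
      (fun x _ => (hf.differentiable one_ne_zero) x)
    simp only [hφ'] at parts
    rw [polar_integral hn _ i2, polar_integral hn _ i1] at parts
    have hnorm : ∀ (s : ℝ) (θ : Sph n), s ∈ Ioi (0:ℝ) → ‖s • (θ : En n)‖ = s := by
      intro s θ hs
      have : ‖(θ : En n)‖ = 1 := by simpa using θ.2
      rw [norm_smul, this, Real.norm_of_nonneg (le_of_lt hs), mul_one]
    have e1 : ∫ s in Ioi (0:ℝ), s ^ (n-1) * Av (fun x => Ψ ‖x‖ * f' x) s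
        = ∫ s in Ioi (0:ℝ), Ψ s * (s ^ (n-1) * Av f' s) := by
      refine setIntegral_congr_fun measurableSet_Ioi fun s hs => ?_
      have : Av (fun x => Ψ ‖x‖ * f' x) s = Ψ s * Av f' s := by
        unfold Av
        rw [← integral_const_mul]
        congr 1; ext θ; beta_reduce; rw [hnorm s θ hs]
      simp only [this]; ring
    have e2 : ∫ s in Ioi (0:ℝ), s ^ (n-1) * Av (fun x => χ ‖x‖ * ⟪x, e⟫ * f x) s
        = ∫ s in Ioi (0:ℝ), χ s * (s ^ (n-1) * Av (fun x => f x * ⟪x, e⟫) s) := by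
      refine setIntegral_congr_fun measurableSet_Ioi fun s hs => ?_
      have : Av (fun x => χ ‖x‖ * ⟪x, e⟫ * f x) s = χ s * Av (fun x => f x * ⟪x, e⟫) s := by
        unfold Av
        rw [← integral_const_mul]
        congr 1; ext θ; beta_reduce; rw [hnorm s θ hs]; ring
      simp only [this]; ring
    rw [e1, e2] at parts
    -- restrict to interval
    have restr : ∀ g : ℝ → ℝ, (∀ s > M, g s = 0) →
        ∫ s in Ioi (0:ℝ), g s = ∫ s in (0:ℝ)..M, g s := by
      intro g hg
      rw [intervalIntegral.integral_of_le hM.le, ← integral_indicator measurableSet_Ioi,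
        ← integral_indicator measurableSet_Ioc]
      congr 1; ext s
      by_cases h0 : 0 < s
      · by_cases h1 : s ≤ M
        · rw [indicator_of_mem (by exact h0), indicator_of_mem (by exact ⟨h0, h1⟩)]
        · rw [indicator_of_mem (by exact h0), indicator_of_notMem (by simp [h1]),
            hg s (not_le.1 h1)]
      · rw [indicator_of_notMem (by exact h0), indicator_of_notMem (by simp [h0])]
    rw [restr _ (fun s hs => by simp [hΨM s hs.le]), restr _ (fun s hs => by simp [hχM s hs])]
      at parts
    have hc1 : Continuous fun s : ℝ => s ^ (n-1) * Av f' s := by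
      have := Av_continuous hcf'; fun_prop
    have ibp := intervalIntegral.integral_mul_deriv_eq_deriv_mul (a := 0) (b := M)
      (u := Ψ) (v := Ib f') (u' := fun s => s * χ s) (v' := fun s => s ^ (n-1) * Av f' s)
      (fun s _ => hΨ s) (fun s _ => Ib_hasDerivAt hcf' s) (hcc.intervalIntegrable _ _)
      (hc1.intervalIntegrable _ _)
    have hz : Ib f' 0 = 0 := by simp [Ib]
    rw [hΨM M le_rfl, hz] at ibp
    rw [ibp] at parts
    have e3 : ∫ s, χ s • F s = ∫ s in (0:ℝ)..M, χ s • F s := by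
      rw [← restr _ (fun s hs => by simp [hχM s hs]), setIntegral_eq_integral_of_forall_compl_eq_zero]
      intro s hs
      simp [hχδ s (lt_of_le_of_lt (by simpa using hs) hδ)]
    rw [e3]
    have hc2 : Continuous fun s : ℝ => s * χ s * Ib f' s := by
      have := Ib_continuous hcf'; fun_prop
    have hc3 : Continuous fun s : ℝ => χ s * (s ^ (n-1) * Av (fun x => f x * ⟪x, e⟫) s) := by
      have := Av_continuous hcg; fun_prop
    have e4 : ∫ s in (0:ℝ)..M, χ s • F s = (∫ s in (0:ℝ)..M, s * χ s * Ib f' s)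
        - ∫ s in (0:ℝ)..M, χ s * (s ^ (n-1) * Av (fun x => f x * ⟪x, e⟫) s) := by
      rw [← intervalIntegral.integral_sub (hc2.intervalIntegrable _ _)
        (hc3.intervalIntegrable _ _)]
      congr 1; ext s; simp only [hF, smul_eq_mul]; ring
    rw [e4]
    linarith
  have h0 : F =ᵐ[volume.restrict (Ioi (0:ℝ))] fun _ => 0 := by
    rw [Filter.EventuallyEq, ae_restrict_iff' measurableSet_Ioi]; exact main
  have := Measure.eqOn_open_of_ae_eq h0 isOpen_Ioi hcF.continuousOn continuousOn_const hr
  simp only [hF] at this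
  linarith


lemma ode_bound {m R : ℝ} (hm : 3 ≤ m) {D F W D' F' W' : ℝ → ℝ}
    (hD : ∀ s, HasDerivAt D (D' s) s) (hF : ∀ s, HasDerivAt F (F' s) s)
    (hW : ∀ s, HasDerivAt W (W' s) s)
    (hW' : ∀ s, 0 < s → s < R → W' s = m * W s / s + 2 * s * (D s - F s))
    (hE' : ∀ s, 0 < s → s < R → 0 ≤ 1 / 2 * D' s - (m - 2) / (2 * m) * F' s
      + (m - 2) / 4 * (W' s / s ^ 2 - 2 * W s / s ^ 3))
    (hF' : ∀ s, 0 < s → s < R → 0 ≤ F' s)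
    (hD0 : ∀ s, 0 < s → s < R → 0 ≤ D s)
    (hW0 : ∀ s, 0 < s → s < R → 0 ≤ W s) (hWz : W 0 = 0) {r : ℝ} (hr : 0 < r) (hrR : r < R) :
    D (r / 2) + F (r / 2) ≤ (2 + m * (4 * (2 + 4 / (m - 2)) + 6) / 3) *
      (1 / 2 * D r - (m - 2) / (2 * m) * F r + (m - 2) / 4 * (W r / r ^ 2)) := by
  have hm2 : 0 < m - 2 := by linarith
  have hm0 : 0 < m := by linarith
  set k : ℝ := 2 + 4 / (m - 2) with hk
  have hkpos : 0 < k := by positivity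
  set E : ℝ → ℝ := fun s => 1 / 2 * D s - (m - 2) / (2 * m) * F s + (m - 2) / 4 * (W s / s ^ 2)
    with hEdef
  have hEd : ∀ s, 0 < s → HasDerivAt E (1 / 2 * D' s - (m - 2) / (2 * m) * F' s
      + (m - 2) / 4 * (W' s / s ^ 2 - 2 * W s / s ^ 3)) s := by
    intro s hs
    have h1 := (((hD s).const_mul (1/2)).sub ((hF s).const_mul ((m - 2) / (2 * m)))).add
      (((hW s).div (hasDerivAt_pow 2 s) (by positivity)).const_mul ((m-2)/4))
    refine h1.congr_deriv ?_
    congr 2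
    field_simp
    push_cast
    ring
  have hmono : MonotoneOn E (Ioo 0 R) := by
    refine monotoneOn_of_hasDerivWithinAt_nonneg (convex_Ioo 0 R)
      (fun s hs => (hEd s hs.1).continuousAt.continuousWithinAt)
      (fun s hs => ?_) (fun s hs => ?_)
      (f' := fun s => 1 / 2 * D' s - (m - 2) / (2 * m) * F' s
      + (m - 2) / 4 * (W' s / s ^ 2 - 2 * W s / s ^ 3))
    · rw [interior_Ioo] at hs
      exact (hEd s hs.1).hasDerivWithinAt
    · rw [interior_Ioo] at hs
      exact hE' s hs.1 hs.2
  have hFmono : MonotoneOn F (Ioo 0 R) := by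
    refine monotoneOn_of_hasDerivWithinAt_nonneg (convex_Ioo 0 R)
      (fun s hs => (hF s).continuousAt.continuousWithinAt)
      (fun s hs => (hF s).hasDerivWithinAt) (fun s hs => ?_)
    rw [interior_Ioo] at hs
    exact hF' s hs.1 hs.2
  -- formula for W'
  have hWE : ∀ s, 0 < s → s < R → W' s = 2 * W s / s + 4 * s * E s - 4 / m * s * F s := by
    intro s h0 h1
    rw [hW' s h0 h1]
    simp only [hEdef]
    field_simp
    ring
  have hWle : ∀ s, 0 < s → s < R → W' s ≤ 2 * k * s * E s := by
    intro s h0 h1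
    have h2 : 2 * k * s * E s - W' s = 4 * s / (m - 2) * D s := by
      rw [hW' s h0 h1, hk]
      simp only [hEdef]
      field_simp
      ring
    have h3 : 0 ≤ 4 * s / (m - 2) * D s := mul_nonneg (by positivity) (hD0 s h0 h1)
    linarith
  have hWb : ∀ s, 0 < s → s < R → W s ≤ k * s ^ 2 * E s := by
    intro s h0 h1
    have hmon : MonotoneOn (fun t => k * t ^ 2 * E s - W t) (Icc 0 s) := by
      have hd : ∀ t, HasDerivAt (fun t => k * t ^ 2 * E s - W t) (2 * k * t * E s - W' t) t := by
        intro t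
        have := (((hasDerivAt_pow 2 t).const_mul k).mul_const (E s)).sub (hW t)
        refine this.congr_deriv ?_
        push_cast; ring
      refine monotoneOn_of_hasDerivWithinAt_nonneg (convex_Icc 0 s)
        (fun t _ => (hd t).continuousAt.continuousWithinAt)
        (fun t _ => (hd t).hasDerivWithinAt) (fun t ht => ?_)
      rw [interior_Icc] at ht
      have h2 := hWle t ht.1 (ht.2.trans h1)
      have h3 : E t ≤ E s := hmono ⟨ht.1, ht.2.trans h1⟩ ⟨h0, h1⟩ ht.2.le
      have h4 : 2 * k * t * E t ≤ 2 * k * t * E s :=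
        mul_le_mul_of_nonneg_left h3 (by have := ht.1; positivity)
      linarith
    have := hmon (left_mem_Icc.2 h0.le) (right_mem_Icc.2 h0.le) h0.le
    simp only [hWz] at this
    linarith
  set a := r / 2 with ha
  have ha0 : 0 < a := by positivity
  have har : a < r := by rw [ha]; linarith
  have haR : a < R := har.trans hrR
  have hmon2 : MonotoneOn (fun t => ((4 + 2 * k) * E r - 4 / m * F a) * t ^ 2 / 2 - W t)
      (Icc a r) := by
    have hd : ∀ t, HasDerivAt (fun t => ((4 + 2 * k) * E r - 4 / m * F a) * t ^ 2 / 2 - W t)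
        (((4 + 2 * k) * E r - 4 / m * F a) * t - W' t) t := by
      intro t
      have := (((hasDerivAt_pow 2 t).const_mul ((4 + 2 * k) * E r - 4 / m * F a)).div_const 2).sub
        (hW t)
      refine this.congr_deriv ?_
      push_cast; ring
    refine monotoneOn_of_hasDerivWithinAt_nonneg (convex_Icc a r)
      (fun t _ => (hd t).continuousAt.continuousWithinAt)
      (fun t _ => (hd t).hasDerivWithinAt) (fun t ht => ?_)
    rw [interior_Icc] at ht
    have ht0 : 0 < t := ha0.trans ht.1
    have htR : t < R := ht.2.trans hrR
    have hE1 : E t ≤ E r := hmono ⟨ht0, htR⟩ ⟨hr, hrR⟩ ht.2.le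
    have hF1 : F a ≤ F t := hFmono ⟨ha0, haR⟩ ⟨ht0, htR⟩ ht.1.le
    have hW1 := hWb t ht0 htR
    rw [hWE t ht0 htR]
    have e1 : 2 * W t / t ≤ 2 * k * t * E r := by
      rw [div_le_iff₀ ht0]
      have : k * t ^ 2 * E t ≤ k * t ^ 2 * E r := mul_le_mul_of_nonneg_left hE1 (by positivity)
      nlinarith
    have e2 : 4 * t * E t ≤ 4 * t * E r := mul_le_mul_of_nonneg_left hE1 (by positivity)
    have e3 : 4 / m * t * F a ≤ 4 / m * t * F t := mul_le_mul_of_nonneg_left hF1 (by positivity)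
    nlinarith
  have hfin := hmon2 (left_mem_Icc.2 har.le) (right_mem_Icc.2 har.le) har.le
  have hWr := hW0 r hr hrR
  have hWa := hWb a ha0 haR
  have hEa : E a ≤ E r := hmono ⟨ha0, haR⟩ ⟨hr, hrR⟩ har.le
  have hWa2 : W a ≤ k * a ^ 2 * E r :=
    hWa.trans (mul_le_mul_of_nonneg_left hEa (by positivity))
  have hr2 : r = 2 * a := by rw [ha]; ring
  have hFa : F a ≤ m * (4 * k + 6) / 6 * E r := by
    simp only [] at hfin
    have h5 : 4 / m * F a * (3 / 2) * a ^ 2 ≤ (k + (4 + 2 * k) * (3 / 2)) * E r * a ^ 2 := by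
      have : r ^ 2 = 4 * a ^ 2 := by rw [hr2]; ring
      rw [this] at hfin
      nlinarith
    have h6 : 4 / m * F a * (3 / 2) ≤ (k + (4 + 2 * k) * (3 / 2)) * E r :=
      le_of_mul_le_mul_right h5 (by positivity)
    have h7 : 4 / m * F a * (3 / 2) = 6 * F a / m := by ring
    rw [h7, div_le_iff₀ hm0] at h6
    linarith
  have hDa : D a = 2 * E a + (m - 2) / m * F a - (m - 2) / 2 * (W a / a ^ 2) := by
    simp only [hEdef]; field_simp; ring
  have hWa0 : 0 ≤ (m - 2) / 2 * (W a / a ^ 2) := by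
    have := hW0 a ha0 haR
    positivity
  have hEr : 0 ≤ E r := by
    have := hWb r hr hrR
    have h8 : 0 ≤ k * r ^ 2 * E r := hWr.trans this
    exact nonneg_of_mul_nonneg_right h8 (by positivity)
  have h9 : D a + F a ≤ 2 * E r + ((m - 2) / m + 1) * F a := by rw [hDa]; linarith
  have hq : (m - 2) / m + 1 = 2 - 2 / m := by field_simp; ring
  have hq2 : 0 ≤ 2 / m := by positivity
  have hq3 : 2 / m ≤ 1 := by rw [div_le_one hm0]; linarith
  have h10 : ((m - 2) / m + 1) * F a ≤ 2 * (m * (4 * k + 6) / 6 * E r) := by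
    rw [hq]
    have h11 : (2 - 2 / m) * F a ≤ (2 - 2 / m) * (m * (4 * k + 6) / 6 * E r) :=
      mul_le_mul_of_nonneg_left hFa (by linarith)
    have h12 : 0 ≤ m * (4 * k + 6) / 6 * E r := by positivity
    nlinarith
  calc D a + F a ≤ 2 * E r + 2 * (m * (4 * k + 6) / 6 * E r) := by linarith
    _ = (2 + m * (4 * k + 6) / 3) * E r := by ring

lemma Av_add {n : ℕ} {f g : En n → ℝ} (hf : Continuous f) (hg : Continuous g) (s : ℝ) :
    Av (fun x => f x + g x) s = Av f s + Av g s :=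
  integral_add (sph_integrable hf s) (sph_integrable hg s)

lemma Av_sub {n : ℕ} {f g : En n → ℝ} (hf : Continuous f) (hg : Continuous g) (s : ℝ) :
    Av (fun x => f x - g x) s = Av f s - Av g s :=
  integral_sub (sph_integrable hf s) (sph_integrable hg s)

lemma Av_const_mul {n : ℕ} (f : En n → ℝ) (c s : ℝ) :
    Av (fun x => c * f x) s = c * Av f s := integral_const_mul _ _

lemma Av_sum {n : ℕ} {ι : Type*} (t : Finset ι) {f : ι → En n → ℝ}
    (hf : ∀ i, Continuous (f i)) (s : ℝ) :
    Av (fun x => ∑ i ∈ t, f i x) s = ∑ i ∈ t, Av (f i) s :=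
  integral_finsetSum _ fun i _ => sph_integrable (hf i) s

lemma Av_nonneg {n : ℕ} {f : En n → ℝ} (hf : ∀ x, 0 ≤ f x) (s : ℝ) : 0 ≤ Av f s :=
  integral_nonneg fun _ => hf _

lemma Av_normsq_mul {n : ℕ} (f : En n → ℝ) (s : ℝ) :
    Av (fun x => ‖x‖ ^ 2 * f x) s = s ^ 2 * Av f s := by
  unfold Av
  rw [← integral_const_mul]
  congr 1; ext θ
  have : ‖(θ : En n)‖ = 1 := by simp
  simp [norm_smul]

lemma Ib_ii {n : ℕ} {f : En n → ℝ} (hf : Continuous f) (r : ℝ) :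
    IntervalIntegrable (fun s : ℝ => s ^ (n-1) * Av f s) volume 0 r := by
  have := Av_continuous hf
  exact Continuous.intervalIntegrable (by fun_prop) _ _

lemma Ib_sub {n : ℕ} {f g : En n → ℝ} (hf : Continuous f) (hg : Continuous g) (r : ℝ) :
    Ib (fun x => f x - g x) r = Ib f r - Ib g r := by
  unfold Ib
  rw [← intervalIntegral.integral_sub (Ib_ii hf r) (Ib_ii hg r)]
  congr 1; ext s; rw [Av_sub hf hg]; ring

lemma Ib_const_mul {n : ℕ} (f : En n → ℝ) (c r : ℝ) :
    Ib (fun x => c * f x) r = c * Ib f r := by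
  unfold Ib
  rw [← intervalIntegral.integral_const_mul]
  congr 1; ext s; rw [Av_const_mul]; ring

lemma Ib_sum {n : ℕ} {ι : Type*} (t : Finset ι) {f : ι → En n → ℝ}
    (hf : ∀ i, Continuous (f i)) (r : ℝ) :
    Ib (fun x => ∑ i ∈ t, f i x) r = ∑ i ∈ t, Ib (f i) r := by
  unfold Ib
  rw [← intervalIntegral.integral_finsetSum fun i _ => Ib_ii (hf i) r]
  congr 1; ext s; rw [Av_sum t hf, Finset.mul_sum]

lemma Ib_nonneg {n : ℕ} {f : En n → ℝ} (hf : ∀ x, 0 ≤ f x) {r : ℝ} (hr : 0 ≤ r) :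
    0 ≤ Ib f r :=
  intervalIntegral.integral_nonneg hr fun s hs =>
    mul_nonneg (pow_nonneg hs.1 _) (Av_nonneg hf s)

/-- basis vectors -/
abbrev bv {n : ℕ} (i : Fin n) : En n := EuclideanSpace.single i 1

lemma inner_bv {n : ℕ} (x : En n) (i : Fin n) : ⟪x, bv i⟫ = x i := by
  simp [EuclideanSpace.inner_single_right]

lemma div_vec {n : ℕ} (hn : 1 ≤ n) {X : Fin n → En n → ℝ} (hX : ∀ i, ContDiff ℝ 1 (X i))
    {r : ℝ} (hr : 0 < r) :
    r * Ib (fun x => ∑ i, fderiv ℝ (X i) x (bv i)) r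
      = r ^ (n-1) * Av (fun x => ∑ i, X i x * x i) r := by
  rw [Ib_sum, Av_sum, Finset.mul_sum, Finset.mul_sum]
  · refine Finset.sum_congr rfl fun i _ => ?_
    have := divergence_ball hn (hX i) (bv i) hr
    simpa only [inner_bv] using this
  · intro i
    have := (hX i).continuous
    fun_prop
  · intro i
    have := (hX i).continuous_fderiv one_ne_zero
    fun_prop

lemma sum_coord_fderiv {n : ℕ} (U : En n → ℝ) (x y : En n) :
    fderiv ℝ U x y = ∑ i, y i * fderiv ℝ U x (bv i) := by
  have h : y = ∑ i, y i • bv i := by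
    ext j
    simp [Finset.sum_apply, Pi.single_apply]
  conv_lhs => rw [h]
  simp

lemma normsq_sum {n : ℕ} (x : En n) : ‖x‖ ^ 2 = ∑ i, x i * x i := by
  rw [EuclideanSpace.norm_sq_eq]; simp [sq]

lemma gradient_normsq {n : ℕ} (U : En n → ℝ) (x : En n) :
    ‖gradient U x‖ ^ 2 = ∑ i, fderiv ℝ U x (bv i) * fderiv ℝ U x (bv i) := by
  rw [normsq_sum]
  have : ∀ i, gradient U x i = fderiv ℝ U x (bv i) := by
    intro i
    rw [← inner_bv]
    simp [gradient]
  simp [this]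


section PDE

variable {n : ℕ} {U : En n → ℝ}

/-- partial derivative -/
def pd (U : En n → ℝ) (i : Fin n) (x : En n) : ℝ := fderiv ℝ U x (bv i)

/-- radial derivative -/
def rd (U : En n → ℝ) (x : En n) : ℝ := ∑ i, x i * pd U i x

/-- squared gradient -/
def gsq (U : En n → ℝ) (x : En n) : ℝ := ∑ i, pd U i x * pd U i x

/-- nonlinear term -/
def nl (U : En n → ℝ) (x : En n) : ℝ := |U x| ^ (2 * (n : ℝ) / ((n : ℝ) - 2))

lemma pd_contDiff (hU : ContDiff ℝ (⊤ : ℕ∞) U) (i : Fin n) : ContDiff ℝ 1 (pd U i) := by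
  have h : ContDiff ℝ 1 (fderiv ℝ U) := hU.fderiv_right (by norm_cast)
  unfold pd
  exact h.clm_apply contDiff_const

lemma coord_contDiff (i : Fin n) : ContDiff ℝ 1 (fun x : En n => x i) := by fun_prop

lemma rd_contDiff (hU : ContDiff ℝ (⊤ : ℕ∞) U) : ContDiff ℝ 1 (rd U) := by
  unfold rd
  exact ContDiff.sum fun i _ => (coord_contDiff i).mul (pd_contDiff hU i)

lemma gsq_contDiff (hU : ContDiff ℝ (⊤ : ℕ∞) U) : ContDiff ℝ 1 (gsq U) := by
  unfold gsq
  exact ContDiff.sum fun i _ => (pd_contDiff hU i).mul (pd_contDiff hU i)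

lemma expo_gt_one (hn : 3 ≤ n) : 1 < 2 * (n : ℝ) / ((n : ℝ) - 2) := by
  have : (3:ℝ) ≤ n := by exact_mod_cast hn
  rw [lt_div_iff₀ (by linarith)]; linarith

lemma U_contDiff1 (hU : ContDiff ℝ (⊤ : ℕ∞) U) : ContDiff ℝ 1 U :=
  hU.of_le (by norm_cast)

lemma nl_contDiff (hn : 3 ≤ n) (hU : ContDiff ℝ (⊤ : ℕ∞) U) : ContDiff ℝ 1 (nl U) := by
  have := (U_contDiff1 hU).norm_rpow (expo_gt_one hn)
  simp only [Real.norm_eq_abs] at this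
  exact this

lemma nl_hasFDerivAt (hn : 3 ≤ n) (hU : ContDiff ℝ (⊤ : ℕ∞) U) (x : En n) :
    HasFDerivAt (nl U) ((2 * (n : ℝ) / ((n : ℝ) - 2) * |U x| ^ ((4:ℝ) / ((n:ℝ) - 2)) * U x) •
      fderiv ℝ U x) x := by
  have h3 : (3:ℝ) ≤ n := by exact_mod_cast hn
  have h1 := hasDerivAt_abs_rpow (U x) (expo_gt_one hn)
  have h2 : 2 * (n : ℝ) / ((n : ℝ) - 2) - 2 = 4 / ((n:ℝ) - 2) := by
    have : (n:ℝ) - 2 ≠ 0 := by linarith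
    field_simp; ring
  rw [h2] at h1
  exact h1.comp_hasFDerivAt x ((U_contDiff1 hU).differentiable one_ne_zero x).hasFDerivAt

lemma hess_symm (hU : ContDiff ℝ (⊤ : ℕ∞) U) (x : En n) (i j : Fin n) :
    fderiv ℝ (pd U j) x (bv i) = fderiv ℝ (pd U i) x (bv j) := by
  have h : ContDiff ℝ 1 (fderiv ℝ U) := hU.fderiv_right (by norm_cast)
  have hd : DifferentiableAt ℝ (fderiv ℝ U) x := h.differentiable one_ne_zero x
  have key : ∀ v w : En n, fderiv ℝ (fun y => fderiv ℝ U y v) x w = fderiv ℝ (fderiv ℝ U) x w v := by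
    intro v w
    rw [fderiv_clm_apply hd (differentiableAt_const v)]
    simp
  have hs : IsSymmSndFDerivAt ℝ U x :=
    (hU.contDiffAt (x := x)).isSymmSndFDerivAt (by simp only [minSmoothness_of_isRCLikeNormedField]; norm_cast)
  unfold pd
  rw [key, key]
  exact hs _ _

/-- derivative along a basis vector of a product -/
lemma fderiv_mul_bv {f g : En n → ℝ} (hf : ContDiff ℝ 1 f) (hg : ContDiff ℝ 1 g) (x v : En n) :
    fderiv ℝ (fun y => f y * g y) x v = f x * fderiv ℝ g x v + g x * fderiv ℝ f x v := by
  rw [fderiv_fun_mul (hf.differentiable one_ne_zero x) (hg.differentiable one_ne_zero x)]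
  simp

lemma fderiv_coord (x v : En n) (i : Fin n) : fderiv ℝ (fun y : En n => y i) x v = v i := by
  have : HasFDerivAt (fun y : En n => y i) (EuclideanSpace.proj (𝕜 := ℝ) i : En n →L[ℝ] ℝ) x :=
    (EuclideanSpace.proj (𝕜 := ℝ) i : En n →L[ℝ] ℝ).hasFDerivAt
  rw [this.fderiv]; rfl

lemma fderiv_rd (hU : ContDiff ℝ (⊤ : ℕ∞) U) (x : En n) (i : Fin n) :
    fderiv ℝ (rd U) x (bv i) = pd U i x + ∑ j, x j * fderiv ℝ (pd U j) x (bv i) := by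
  unfold rd
  rw [fderiv_fun_sum fun j _ =>
    (((coord_contDiff j).mul (pd_contDiff hU j)).differentiable one_ne_zero x)]
  simp only [_root_.sum_apply]
  simp_rw [fun j => fderiv_mul_bv (coord_contDiff j) (pd_contDiff hU j) x (bv i), fderiv_coord]
  rw [Finset.sum_add_distrib, add_comm]
  congr 1
  simp [Pi.single_apply]

lemma fderiv_gsq (hU : ContDiff ℝ (⊤ : ℕ∞) U) (x : En n) (i : Fin n) :
    fderiv ℝ (gsq U) x (bv i) = 2 * ∑ j, pd U j x * fderiv ℝ (pd U j) x (bv i) := by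
  unfold gsq
  rw [fderiv_fun_sum fun j _ =>
    (((pd_contDiff hU j).mul (pd_contDiff hU j)).differentiable one_ne_zero x)]
  simp only [_root_.sum_apply]
  simp_rw [fun j => fderiv_mul_bv (pd_contDiff hU j) (pd_contDiff hU j) x (bv i)]
  rw [Finset.mul_sum]
  exact Finset.sum_congr rfl fun j _ => by ring

/-- the Lagrangian density -/
def lag (U : En n → ℝ) (x : En n) : ℝ :=
  1 / 2 * gsq U x - ((n : ℝ) - 2) / (2 * n) * nl U x

lemma lag_contDiff (hn : 3 ≤ n) (hU : ContDiff ℝ (⊤ : ℕ∞) U) : ContDiff ℝ 1 (lag U) :=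
  (contDiff_const.mul (gsq_contDiff hU)).sub (contDiff_const.mul (nl_contDiff hn hU))

lemma fderiv_lag (hn : 3 ≤ n) (hU : ContDiff ℝ (⊤ : ℕ∞) U) (x : En n) (i : Fin n) :
    fderiv ℝ (lag U) x (bv i) = ∑ j, pd U j x * fderiv ℝ (pd U j) x (bv i)
      - |U x| ^ ((4:ℝ) / ((n:ℝ) - 2)) * U x * pd U i x := by
  have h3 : (3:ℝ) ≤ n := by exact_mod_cast hn
  have h1 := ((gsq_contDiff hU).differentiable one_ne_zero x).hasFDerivAt.const_mul (1/2)
  have h2 := (nl_hasFDerivAt hn hU x).const_mul (((n : ℝ) - 2) / (2 * n))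
  have h : HasFDerivAt (lag U) _ x := h1.sub h2
  rw [h.fderiv]
  simp only [ContinuousLinearMap.sub_apply, ContinuousLinearMap.smul_apply, smul_eq_mul,
    fderiv_gsq hU]
  unfold pd
  have : (n:ℝ) - 2 ≠ 0 := by linarith
  field_simp

/-- Identity (i): testing with `u` -/
lemma ident1 (hn : 3 ≤ n) (hU : ContDiff ℝ (⊤ : ℕ∞) U) {R : ℝ}
    (heq : ∀ x, ‖x‖ < R → -lap U x = U x * |U x| ^ ((4 : ℝ) / ((n : ℝ) - 2)))
    {r : ℝ} (hr : 0 < r) (hrR : r < R) :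
    r * (Ib (gsq U) r - Ib (nl U) r) = r ^ (n-1) * Av (fun x => U x * rd U x) r := by
  have h3 : (3:ℝ) ≤ n := by exact_mod_cast hn
  have h := div_vec (by omega) (X := fun i x => U x * pd U i x)
    (fun i => (U_contDiff1 hU).mul (pd_contDiff hU i)) hr
  have e1 : Ib (fun x => ∑ i, fderiv ℝ (fun y => U y * pd U i y) x (bv i)) r
      = Ib (gsq U) r - Ib (nl U) r := by
    rw [← Ib_sub (gsq_contDiff hU).continuous (nl_contDiff hn hU).continuous]
    refine Ib_congr hr.le hrR fun x hx => ?_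
    simp_rw [fun i => fderiv_mul_bv (U_contDiff1 hU) (pd_contDiff hU i) x (bv i)]
    rw [Finset.sum_add_distrib, ← Finset.mul_sum, add_comm]
    have hl : ∑ i, fderiv ℝ (pd U i) x (bv i) = lap U x := rfl
    rw [hl, sub_eq_add_neg]
    congr 1
    have hl2 : lap U x = -(U x * |U x| ^ ((4 : ℝ) / ((n : ℝ) - 2))) := by
      rw [← heq x hx]; ring
    rw [hl2]
    have h4 : nl U x = |U x| ^ ((4 : ℝ) / ((n : ℝ) - 2)) * (U x * U x) := by
      unfold nl
      have h5 : 2 * (n : ℝ) / ((n : ℝ) - 2) = 4 / ((n:ℝ) - 2) + 2 := by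
        have : (n:ℝ) - 2 ≠ 0 := by linarith
        field_simp; ring
      have h6 : 0 < (4 : ℝ) / ((n : ℝ) - 2) := div_pos (by norm_num) (by linarith)
      rw [h5, Real.rpow_add_of_nonneg (abs_nonneg _) h6.le (by norm_num)]
      congr 1
      rw [Real.rpow_two, sq_abs, sq]
    rw [h4]; ring
  have e2 : (fun x => ∑ i, U x * pd U i x * x i) = fun x => U x * rd U x := by
    ext x; unfold rd; rw [Finset.mul_sum]
    exact Finset.sum_congr rfl fun i _ => by ring
  rw [e1] at h
  rw [h]
  exact congrArg (fun f => r ^ (n-1) * Av f r) e2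

/-- Identity (ii): Pohozaev -/
lemma ident2 (hn : 3 ≤ n) (hU : ContDiff ℝ (⊤ : ℕ∞) U) {R : ℝ}
    (heq : ∀ x, ‖x‖ < R → -lap U x = U x * |U x| ^ ((4 : ℝ) / ((n : ℝ) - 2)))
    {r : ℝ} (hr : 0 < r) (hrR : r < R) :
    r * (-((n:ℝ) - 2) / 2 * (Ib (gsq U) r - Ib (nl U) r))
      = r ^ (n-1) * (Av (fun x => rd U x * rd U x) r - r ^ 2 * Av (lag U) r) := by
  have h3 : (3:ℝ) ≤ n := by exact_mod_cast hn
  have hX : ∀ i : Fin n, ContDiff ℝ 1 (fun x => rd U x * pd U i x - x i * lag U x) := fun i =>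
    ((rd_contDiff hU).mul (pd_contDiff hU i)).sub ((coord_contDiff i).mul (lag_contDiff hn hU))
  have h := div_vec (by omega) (X := fun i x => rd U x * pd U i x - x i * lag U x) hX hr
  have e1 : Ib (fun x => ∑ i, fderiv ℝ (fun y => rd U y * pd U i y - y i * lag U y) x (bv i)) r
      = -((n:ℝ) - 2) / 2 * (Ib (gsq U) r - Ib (nl U) r) := by
    rw [← Ib_sub (gsq_contDiff hU).continuous (nl_contDiff hn hU).continuous, ← Ib_const_mul]
    refine Ib_congr hr.le hrR fun x hx => ?_
    have hd : ∀ i : Fin n, fderiv ℝ (fun y => rd U y * pd U i y - y i * lag U y) x (bv i)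
        = rd U x * fderiv ℝ (pd U i) x (bv i) + pd U i x * pd U i x
          + (∑ j, pd U i x * (x j * fderiv ℝ (pd U j) x (bv i)))
          - (∑ j, x i * (pd U j x * fderiv ℝ (pd U j) x (bv i)))
          + |U x| ^ ((4:ℝ) / ((n:ℝ) - 2)) * U x * (x i * pd U i x) - lag U x := by
      intro i
      rw [fderiv_fun_sub
        (((rd_contDiff hU).mul (pd_contDiff hU i)).differentiable one_ne_zero x)
        (((coord_contDiff i).mul (lag_contDiff hn hU)).differentiable one_ne_zero x),
        ContinuousLinearMap.sub_apply, fderiv_mul_bv (rd_contDiff hU) (pd_contDiff hU i),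
        fderiv_mul_bv (coord_contDiff i) (lag_contDiff hn hU), fderiv_coord, fderiv_rd hU,
        fderiv_lag hn hU, ← Finset.mul_sum, ← Finset.mul_sum]
      have : (bv i : En n) i = 1 := by simp
      rw [this]; ring
    simp_rw [hd]
    rw [Finset.sum_sub_distrib, Finset.sum_add_distrib, Finset.sum_sub_distrib,
      Finset.sum_add_distrib, Finset.sum_add_distrib, ← Finset.mul_sum, ← Finset.mul_sum]
    have hl : ∑ i, fderiv ℝ (pd U i) x (bv i) = lap U x := rfl
    have hl2 : lap U x = -(U x * |U x| ^ ((4 : ℝ) / ((n : ℝ) - 2))) := by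
      rw [← heq x hx]; ring
    have hsw : ∑ i, ∑ j, pd U i x * (x j * fderiv ℝ (pd U j) x (bv i))
        = ∑ i, ∑ j, x i * (pd U j x * fderiv ℝ (pd U j) x (bv i)) := by
      rw [Finset.sum_comm]
      refine Finset.sum_congr rfl fun i _ => Finset.sum_congr rfl fun j _ => ?_
      rw [hess_symm hU x j i]; ring
    rw [hl, hl2, hsw]
    have hr1 : ∑ i, x i * pd U i x = rd U x := rfl
    have hr2 : ∑ i, pd U i x * pd U i x = gsq U x := rfl
    rw [hr1, hr2]
    simp only [Finset.sum_const, Finset.card_univ, Fintype.card_fin, nsmul_eq_mul]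
    unfold lag
    have : (n:ℝ) ≠ 0 := by linarith
    field_simp
    ring
  have hc1 : Continuous fun x => rd U x * rd U x := by
    have := (rd_contDiff hU).continuous; fun_prop
  have hc2 : Continuous fun x => ‖x‖ ^ 2 * lag U x := by
    have := (lag_contDiff hn hU).continuous; fun_prop
  have e2 : (fun x => ∑ i, (rd U x * pd U i x - x i * lag U x) * x i)
      = fun x => rd U x * rd U x - ‖x‖ ^ 2 * lag U x := by
    ext x
    rw [normsq_sum, Finset.sum_mul]
    conv_rhs => enter [1, 2]; unfold rd
    rw [Finset.mul_sum, ← Finset.sum_sub_distrib]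
    exact Finset.sum_congr rfl fun i _ => by ring
  rw [e1] at h
  rw [h, ← Av_normsq_mul, ← Av_sub hc1 hc2]
  exact congrArg (fun f => r ^ (n-1) * Av f r) e2

/-- density whose ball integral is `r^n ∫ u²` -/
def wden (U : En n → ℝ) (x : En n) : ℝ := n * (U x * U x) + 2 * (U x * rd U x)

lemma ident3 (hn : 3 ≤ n) (hU : ContDiff ℝ (⊤ : ℕ∞) U) {r : ℝ} (hr : 0 < r) :
    Ib (wden U) r = r ^ n * Av (fun x => U x * U x) r := by
  have hU1 := U_contDiff1 hU
  have h := div_vec (by omega) (X := fun i x => U x * U x * x i)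
    (fun i => (hU1.mul hU1).mul (coord_contDiff i)) hr
  have e1 : (fun x => ∑ i, fderiv ℝ (fun y => U y * U y * y i) x (bv i)) = wden U := by
    ext x
    simp_rw [fun i => fderiv_mul_bv (hU1.mul hU1) (coord_contDiff i) x (bv i), fderiv_coord,
      fun i => fderiv_mul_bv hU1 hU1 x (bv i)]
    have : ∀ i, (bv i : En n) i = 1 := by simp
    simp_rw [this]
    rw [Finset.sum_add_distrib]
    unfold wden rd pd
    congr 1
    · simp
    · rw [Finset.mul_sum, Finset.mul_sum]
      exact Finset.sum_congr rfl fun i _ => by ring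
  have e2 : (fun x => ∑ i, U x * U x * x i * x i) = fun x => ‖x‖ ^ 2 * (U x * U x) := by
    ext x
    rw [normsq_sum, Finset.sum_mul]
    exact Finset.sum_congr rfl fun i _ => by ring
  have h' : r * Ib (wden U) r = r ^ (n-1) * Av (fun x => ‖x‖ ^ 2 * (U x * U x)) r := by
    rw [← e1, h]
    exact congrArg (fun f => r ^ (n-1) * Av f r) e2
  rw [Av_normsq_mul] at h'
  have hp : r ^ n = r ^ (n-1) * r := by rw [← pow_succ]; congr 1; omega
  rw [hp]
  apply mul_left_cancel₀ hr.ne'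
  rw [h']; ring

lemma core_bound (hn : 3 ≤ n) (hU : ContDiff ℝ (⊤ : ℕ∞) U) {R : ℝ}
    (heq : ∀ x, ‖x‖ < R → -lap U x = U x * |U x| ^ ((4 : ℝ) / ((n : ℝ) - 2)))
    {r : ℝ} (hr : 0 < r) (hrR : r < R) :
    Ib (gsq U) (r / 2) + Ib (nl U) (r / 2)
      ≤ (2 + n * (4 * (2 + 4 / ((n:ℝ) - 2)) + 6) / 3) *
      (1 / 2 * Ib (gsq U) r - ((n:ℝ) - 2) / (2 * n) * Ib (nl U) r
        + ((n:ℝ) - 2) / (4 * r) * (r ^ (n - 1) * Av (fun x => U x * U x) r)) := by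
  have h3 : (3:ℝ) ≤ n := by exact_mod_cast hn
  have hn0 : (n:ℝ) ≠ 0 := by linarith
  have cU := (U_contDiff1 hU).continuous
  have cr := (rd_contDiff hU).continuous
  have cg := (gsq_contDiff hU).continuous
  have cn := (nl_contDiff hn hU).continuous
  have cw : Continuous (wden U) := by unfold wden; fun_prop
  have hp : ∀ s : ℝ, s ^ n = s ^ (n-1) * s := fun s => by rw [← pow_succ]; congr 1; omega
  have hAw : ∀ s, Av (wden U) s = n * Av (fun x => U x * U x) s
      + 2 * Av (fun x => U x * rd U x) s := by
    intro s
    unfold wden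
    rw [Av_add (by fun_prop) (by fun_prop), Av_const_mul, Av_const_mul]
  have hAl : ∀ s, Av (lag U) s = 1 / 2 * Av (gsq U) s - ((n:ℝ) - 2) / (2 * n) * Av (nl U) s := by
    intro s
    unfold lag
    rw [Av_sub (by fun_prop) (by fun_prop), Av_const_mul, Av_const_mul]
  have hgn : ∀ x, 0 ≤ gsq U x := fun x => Finset.sum_nonneg fun i _ => mul_self_nonneg _
  have hnn : ∀ x, 0 ≤ nl U x := fun x => by unfold nl; positivity
  have key := ode_bound (R := R) h3 (D := Ib (gsq U)) (F := Ib (nl U)) (W := Ib (wden U))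
    (Ib_hasDerivAt cg) (Ib_hasDerivAt cn) (Ib_hasDerivAt cw)
    (fun s h0 h1 => ?_) (fun s h0 h1 => ?_) (fun s h0 h1 => ?_) (fun s h0 h1 => ?_)
    (fun s h0 h1 => ?_) (by simp [Ib]) hr hrR
  · refine key.trans_eq ?_
    rw [ident3 hn hU hr, hp]
    congr 2
    field_simp
  · rw [hAw, ident3 hn hU h0, hp]
    have := ident1 hn hU heq h0 h1
    field_simp
    linear_combination -2 * this
  · have i1 := ident1 hn hU heq h0 h1
    have i2 := ident2 hn hU heq h0 h1
    have i3 := ident3 hn hU h0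
    have hsq : 0 ≤ Av (fun x => (rd U x * rd U x + (((n:ℝ) - 2) * (U x * rd U x)
        + ((n:ℝ) - 2) ^ 2 / 4 * (U x * U x)))) s := by
      refine Av_nonneg (fun x => ?_) s
      have : 0 ≤ (rd U x + ((n:ℝ) - 2) / 2 * U x) ^ 2 := sq_nonneg _
      nlinarith
    rw [Av_add (by fun_prop) (by fun_prop), Av_add (by fun_prop) (by fun_prop), Av_const_mul,
      Av_const_mul] at hsq
    have hpos : 0 < s ^ (n-1) := by positivity
    have hsq' := mul_nonneg hpos.le hsq
    rw [i3, hAw, hp]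
    rw [hAl] at i2
    set P := s ^ (n-1)
    set a1 := Av (fun x => U x * U x) s
    set a2 := Av (fun x => U x * rd U x) s
    set a3 := Av (fun x => rd U x * rd U x) s
    set a4 := Av (gsq U) s
    set a5 := Av (nl U) s
    set d := Ib (gsq U) s - Ib (nl U) s
    have : 1 / 2 * (P * a4) - ((n:ℝ) - 2) / (2 * n) * (P * a5)
        + ((n:ℝ) - 2) / 4 * (P * (n * a1 + 2 * a2) / s ^ 2 - 2 * (P * s * a1) / s ^ 3)
        = (P * (a3 + (((n:ℝ) - 2) * a2 + ((n:ℝ) - 2) ^ 2 / 4 * a1))) / s ^ 2 := by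
      have e : s ^ 2 * (1 / 2 * (P * a4) - ((n:ℝ) - 2) / (2 * n) * (P * a5))
          = P * a3 + ((n:ℝ) - 2) / 2 * (P * a2) := by
        linear_combination i2 + ((n:ℝ) - 2) / 2 * i1
      have hs2 : s ^ 2 ≠ 0 := by positivity
      rw [eq_div_iff hs2, add_mul, mul_comm _ (s ^ 2), e]
      field_simp
      ring
    rw [this]
    positivity
  · exact mul_nonneg (by positivity) (Av_nonneg hnn s)
  · exact Ib_nonneg hgn h0.le
  · rw [ident3 hn hU h0]
    exact mul_nonneg (by positivity) (Av_nonneg (fun x => mul_self_nonneg _) s)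

end PDE


section HausFin

lemma normalize_lip {E : Type*} [NormedAddCommGroup E] [NormedSpace ℝ E] :
    LipschitzOnWith 2 (fun y : E => ‖y‖⁻¹ • y) {y | 1 ≤ ‖y‖} := by
  refine LipschitzOnWith.of_dist_le_mul fun x hx y hy => ?_
  simp only [mem_setOf_eq] at hx hy
  have hx0 : ‖x‖ ≠ 0 := by positivity
  have hy0 : ‖y‖ ≠ 0 := by positivity
  rw [dist_eq_norm, dist_eq_norm]
  have e : ‖x‖⁻¹ • x - ‖y‖⁻¹ • y = ‖x‖⁻¹ • (x - y) + (‖x‖⁻¹ - ‖y‖⁻¹) • y := by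
    rw [smul_sub, sub_smul]; abel
  rw [e]
  refine (norm_add_le _ _).trans ?_
  rw [norm_smul, norm_smul, norm_inv, norm_norm, Real.norm_eq_abs]
  have e2 : |‖x‖⁻¹ - ‖y‖⁻¹| * ‖y‖ = ‖x‖⁻¹ * |‖y‖ - ‖x‖| := by
    rw [inv_sub_inv hx0 hy0, abs_div, abs_mul, abs_norm, abs_norm]
    field_simp
  rw [e2]
  have h1 : |‖y‖ - ‖x‖| ≤ ‖x - y‖ := by
    rw [norm_sub_rev]; exact abs_norm_sub_norm_le y x
  have h2 : ‖x‖⁻¹ ≤ 1 := inv_le_one_of_one_le₀ hx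
  have h3 : 0 ≤ ‖x‖⁻¹ := by positivity
  have h4 : ‖x‖⁻¹ * ‖x - y‖ ≤ 1 * ‖x - y‖ := by gcongr
  have h5 : ‖x‖⁻¹ * |‖y‖ - ‖x‖| ≤ 1 * ‖x - y‖ := by gcongr
  push_cast
  linarith

/-- a face of the cube -/
def faceMap {m : ℕ} (i : Fin (m+1)) (c : ℝ) (y : Fin m → ℝ) : En (m+1) :=
  WithLp.toLp 2 (i.insertNth c y : Fin (m+1) → ℝ)

lemma faceMap_lip {m : ℕ} (i : Fin (m+1)) (c : ℝ) :
    ∃ K : ℝ≥0, LipschitzWith K (faceMap i c) := by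
  have h1 : LipschitzWith 1 (fun y : Fin m → ℝ => (i.insertNth c y : Fin (m+1) → ℝ)) := by
    refine LipschitzWith.of_dist_le_mul fun x y => ?_
    simp only [NNReal.coe_one, one_mul]
    rw [dist_pi_le_iff dist_nonneg]
    intro j
    refine Fin.succAboveCases i ?_ (fun k => ?_) j
    · simp
    · simp only [Fin.insertNth_apply_succAbove]
      exact dist_le_pi_dist x y k
  exact ⟨_, (PiLp.lipschitzWith_toLp 2 (fun _ : Fin (m+1) => ℝ)).comp h1⟩

lemma sphere_subset_faces {m : ℕ} : sphere (0 : En (m+1)) 1 ⊆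
    ⋃ i : Fin (m+1), ⋃ c ∈ ({1, -1} : Finset ℝ),
      (fun y : En (m+1) => ‖y‖⁻¹ • y) '' (faceMap i c '' (Icc (-1) 1)) := by
  intro p hp
  have hp1 : ‖p‖ = 1 := by simpa using hp
  obtain ⟨i, hi⟩ := Finite.exists_max (fun j => |p j|)
  have hpos : 0 < |p i| := by
    by_contra h
    have : p = 0 := by
      ext j
      have h1 := hi j
      have h2 : |p j| ≤ 0 := by linarith [not_lt.1 h]
      simpa using h2
    rw [this] at hp1; simp at hp1
  have hne : p i ≠ 0 := abs_pos.1 hpos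
  simp only [mem_iUnion]
  refine ⟨i, |p i|⁻¹ * p i, ?_, ?_⟩
  · rcases abs_choice (p i) with h | h <;> rw [h] <;> simp [hne]
  · refine ⟨|p i|⁻¹ • p, ⟨fun k => |p i|⁻¹ * p (i.succAbove k), ?_, ?_⟩, ?_⟩
    · rw [mem_Icc, Pi.le_def, Pi.le_def]
      have : ∀ k, |(|p i|⁻¹ * p (i.succAbove k))| ≤ 1 := by
        intro k
        rw [abs_mul, abs_inv, abs_abs, inv_mul_le_iff₀ hpos, mul_one]
        exact hi _
      exact ⟨fun k => (abs_le.1 (this k)).1, fun k => (abs_le.1 (this k)).2⟩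
    · ext j
      unfold faceMap
      refine Fin.succAboveCases i ?_ (fun k => ?_) j <;> simp
    · simp only [norm_smul, hp1, norm_inv, Real.norm_eq_abs, abs_abs, mul_one, inv_inv, smul_smul]
      rw [mul_inv_cancel₀ hpos.ne', one_smul]

lemma faceMap_norm {m : ℕ} (i : Fin (m+1)) (c : ℝ) (hc : |c| = 1) (y : Fin m → ℝ) :
    1 ≤ ‖faceMap i c y‖ := by
  have := PiLp.norm_apply_le (faceMap i c y) i
  have h2 : (faceMap i c y) i = c := by simp [faceMap]
  rw [h2, Real.norm_eq_abs, hc] at this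
  exact this

lemma sphere_hausdorff_finite {n : ℕ} (hn : 1 ≤ n) :
    μH[(n:ℝ) - 1] (sphere (0 : En n) 1) < ⊤ := by
  obtain ⟨m, rfl⟩ : ∃ m, n = m + 1 := ⟨n - 1, by omega⟩
  have hd : ((m+1 : ℕ) : ℝ) - 1 = m := by push_cast; ring
  rw [hd]
  refine (measure_mono sphere_subset_faces).trans_lt ?_
  refine (measure_iUnion_le _).trans_lt ?_
  rw [tsum_fintype]
  refine ENNReal.sum_lt_top.2 fun i _ => ?_
  refine (measure_biUnion_finset_le _ _).trans_lt ?_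
  refine ENNReal.sum_lt_top.2 fun c hc => ?_
  have hc1 : |c| = 1 := by
    simp only [Finset.mem_insert, Finset.mem_singleton] at hc
    rcases hc with rfl | rfl <;> simp
  obtain ⟨K, hK⟩ := faceMap_lip i c
  have hm : (0:ℝ) ≤ m := by positivity
  have hN : LipschitzOnWith 2 (fun y : En (m+1) => ‖y‖⁻¹ • y) (faceMap i c '' (Icc (-1) 1)) :=
    normalize_lip.mono (by rintro _ ⟨y, _, rfl⟩; exact faceMap_norm i c hc1 y)
  refine (hN.hausdorffMeasure_image_le hm).trans_lt ?_
  refine ENNReal.mul_lt_top (ENNReal.rpow_lt_top_of_nonneg hm (by simp)) ?_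
  refine (hK.hausdorffMeasure_image_le hm _).trans_lt ?_
  refine ENNReal.mul_lt_top (ENNReal.rpow_lt_top_of_nonneg hm (by simp)) ?_
  have : μH[(m:ℝ)] = (volume : Measure (Fin m → ℝ)) := by
    have := hausdorffMeasure_pi_real (ι := Fin m)
    simpa using this
  rw [this]
  exact isCompact_Icc.measure_lt_top

end HausFin


section HausLow

open scoped Pointwise

variable {n : ℕ}

lemma box_bound (b : OrthonormalBasis (Fin n) ℝ (En n)) (S : Set (En n)) :
    volume S ≤ ∏ i, ediam ((fun y => ⟪b i, y⟫) '' S) := by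
  let e : En n ≃ᵐ (Fin n → ℝ) := b.measurableEquiv.trans (MeasurableEquiv.toLp 2 (Fin n → ℝ)).symm
  have he : MeasurePreserving e volume volume :=
    (EuclideanSpace.volume_preserving_symm_measurableEquiv_toLp (Fin n)).comp
      b.measurePreserving_measurableEquiv
  have h1 : volume (e '' S) = volume S := by
    rw [← he.measure_preimage_equiv, preimage_image_eq _ e.injective]
  rw [← h1]
  refine (Real.volume_pi_le_prod_diam _).trans_eq ?_
  refine Finset.prod_congr rfl fun i _ => ?_
  rw [image_image]
  congr 1
  refine image_congr fun y _ => ?_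
  exact b.repr_apply_apply y i

lemma exists_onb (hn : 1 ≤ n) (p : En n) (hp : ‖p‖ = 1) :
    ∃ (b : OrthonormalBasis (Fin n) ℝ (En n)) (i : Fin n), b i = p := by
  let i0 : Fin n := ⟨0, by omega⟩
  have ho : Orthonormal ℝ (({i0} : Set (Fin n)).domRestrict (fun _ => p)) := by
    constructor
    · intro i; exact hp
    · intro i j hij
      exact absurd (Subsingleton.elim i j) hij
  obtain ⟨b, hb⟩ := ho.exists_orthonormalBasis_extension_of_card_eq (by simp)
  exact ⟨b, i0, hb i0 rfl⟩

lemma seg_bound {t t' x x' d : ℝ} (ht : 0 ≤ t) (ht1 : t ≤ 1) (ht' : 0 ≤ t') (ht1' : t' ≤ 1)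
    (hx : |x| ≤ d) (hx' : |x'| ≤ d) (hxx : |x - x'| ≤ d) : |t * x - t' * x'| ≤ d := by
  rw [abs_le] at *
  have aux : ∀ s z : ℝ, 0 ≤ s → s ≤ 1 → (s * z ≤ z ∧ 0 ≤ s * z) ∨ (s * z ≤ 0 ∧ z ≤ s * z) := by
    intro s z h0 h1
    rcases le_total 0 z with h | h
    · left; constructor <;> nlinarith
    · right; constructor <;> nlinarith
  rcases aux t x ht ht1 with h | h <;> rcases aux t' x' ht' ht1' with h' | h' <;>
    constructor <;> linarith

lemma sig_small (hn : 1 ≤ n) {δ : ℝ} (h0 : 0 < δ) (h1 : δ < 1) (A : Set (Sph n))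
    (hA : MeasurableSet A) (hd : ediam A ≤ ENNReal.ofReal δ) :
    ENNReal.ofReal ((1 - δ) ^ n / (1 + δ)) * sig n A ≤ ediam A ^ (n - 1) := by
  rcases A.eq_empty_or_nonempty with rfl | ⟨p, hpA⟩
  · simp
  have hp : ‖(p : En n)‖ = 1 := by simpa using p.2
  have hsn : ∀ a : Sph n, ‖(a : En n)‖ = 1 := fun a => by simpa using a.2
  obtain ⟨b, i0, hb⟩ := exists_onb hn (p : En n) hp
  have hfin : ediam A ≠ ⊤ := (hd.trans_lt ENNReal.ofReal_lt_top).ne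
  set d := (ediam A).toReal with hdd
  have hdA : ediam A = ENNReal.ofReal d := (ENNReal.ofReal_toReal hfin).symm
  have hd0 : 0 ≤ d := ENNReal.toReal_nonneg
  have hdδ : d ≤ δ := by
    rw [hdA] at hd
    exact (ENNReal.ofReal_le_ofReal_iff h0.le).1 hd
  have hdist : ∀ a ∈ A, ∀ a' ∈ A, ‖(a : En n) - a'‖ ≤ d := by
    intro a ha a' ha'
    have := edist_le_ediam_of_mem ha ha'
    rw [hdA, edist_dist] at this
    have := (ENNReal.ofReal_le_ofReal_iff hd0).1 this
    rwa [Subtype.dist_eq, dist_eq_norm] at this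
  set Q : Set (En n) := Ioo (0:ℝ) 1 • (Subtype.val '' A) with hQ
  have hsig : sig n A = n * volume Q := by
    have := Measure.toSphere_apply' (volume : Measure (En n)) hA
    rw [this]; simp [hQ]
  have hQfin : volume Q ≠ ⊤ := by
    have hQs : Q ⊆ ball 0 1 := by
      rintro _ ⟨t, ht, _, ⟨a, ha, rfl⟩, rfl⟩
      simp only [mem_ball_zero_iff, norm_smul, hsn, mul_one, Real.norm_eq_abs]
      rw [abs_of_pos ht.1]; exact ht.2
    exact (measure_mono hQs |>.trans_lt measure_ball_lt_top).ne
  set c := 1 - δ with hc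
  have hc0 : 0 < c := by linarith
  set Sh := Q \ (c • Q) with hSh
  have hShmem : ∀ y ∈ Sh, ∃ t : ℝ, ∃ a ∈ A, c ≤ t ∧ t < 1 ∧ y = t • (a : En n) := by
    rintro y ⟨⟨t, ht, _, ⟨a, ha, rfl⟩, rfl⟩, hy⟩
    refine ⟨t, a, ha, ?_, ht.2, rfl⟩
    by_contra hlt
    apply hy
    refine ⟨(t / c) • (a : En n), ⟨t / c, ⟨by have := ht.1; positivity, ?_⟩, _, ⟨a, ha, rfl⟩, rfl⟩, ?_⟩
    · rw [div_lt_one hc0]; exact not_le.1 hlt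
    · simp only [smul_smul]
      rw [mul_div_cancel₀ _ hc0.ne']
  have hbox : volume Sh ≤ ENNReal.ofReal (δ * (1 + δ)) * ENNReal.ofReal d ^ (n - 1) := by
    refine (box_bound b Sh).trans ?_
    rw [← Finset.mul_prod_erase _ _ (Finset.mem_univ i0)]
    refine mul_le_mul' ?_ ?_
    · refine ediam_le ?_
      rintro _ ⟨y, hy, rfl⟩ _ ⟨y', hy', rfl⟩
      have key : ∀ y ∈ Sh, (1 - δ) * (1 - δ^2/2) ≤ ⟪b i0, y⟫ ∧ ⟪b i0, y⟫ ≤ 1 := by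
        intro y hy
        obtain ⟨t, a, ha, ht, ht1, rfl⟩ := hShmem y hy
        rw [hb, inner_smul_right]
        have e := norm_sub_sq_real (p : En n) a
        rw [hsn, hsn] at e
        have e1 := hdist p hpA a ha
        have e2 : ‖(p : En n) - a‖ ^ 2 ≤ δ ^ 2 := by gcongr; linarith
        have e3 := sq_nonneg ‖(p : En n) - a‖
        have e4 : 1 - δ ^ 2 / 2 ≤ ⟪(p : En n), a⟫ := by linarith
        have e5 : ⟪(p : En n), a⟫ ≤ 1 := by linarith
        have e6 : 0 ≤ 1 - δ ^ 2 / 2 := by nlinarith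
        constructor
        · exact mul_le_mul ht e4 e6 (by linarith)
        · nlinarith
      rw [edist_dist]
      refine ENNReal.ofReal_le_ofReal ?_
      rw [Real.dist_eq, abs_le]
      have k1 := key y hy
      have k2 := key y' hy'
      constructor <;> nlinarith [mul_pos h0 h0, mul_pos h0 (mul_pos h0 h0)]
    · have hcard : (Finset.univ.erase i0).card = n - 1 := by
        rw [Finset.card_erase_of_mem (Finset.mem_univ _)]; simp
      rw [← hcard]
      refine Finset.prod_le_pow_card _ _ _ fun i hi => ?_
      have hii : i ≠ i0 := Finset.ne_of_mem_erase hi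
      refine ediam_le ?_
      rintro _ ⟨y, hy, rfl⟩ _ ⟨y', hy', rfl⟩
      obtain ⟨t, a, ha, ht, ht1, rfl⟩ := hShmem y hy
      obtain ⟨t', a', ha', ht', ht1', rfl⟩ := hShmem y' hy'
      rw [edist_dist]
      refine ENNReal.ofReal_le_ofReal ?_
      simp only [Real.dist_eq, inner_smul_right]
      have hz : ⟪b i, (p : En n)⟫ = 0 := by
        rw [← hb]; exact b.orthonormal.2 hii
      have hcs : ∀ v : En n, |⟪b i, v⟫| ≤ ‖v‖ := by
        intro v
        have := abs_real_inner_le_norm (b i) v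
        rwa [b.orthonormal.1 i, one_mul] at this
      have hav : ∀ a ∈ A, |⟪b i, (a : En n)⟫| ≤ d := by
        intro a ha
        have e1 : ⟪b i, (a : En n)⟫ = ⟪b i, (a : En n) - p⟫ := by
          rw [inner_sub_right, hz, sub_zero]
        rw [e1]
        exact (hcs _).trans (hdist a ha p hpA)
      refine seg_bound (by linarith) ht1.le (by linarith) ht1'.le (hav a ha) (hav a' ha') ?_
      rw [← inner_sub_right]
      exact (hcs _).trans (hdist a ha a' ha')
  have hvol : volume Q ≤ ENNReal.ofReal (δ * (1 + δ)) * ENNReal.ofReal d ^ (n - 1)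
      + ENNReal.ofReal (c ^ n) * volume Q := by
    have hsub : Q ⊆ Sh ∪ c • Q := by rw [hSh, diff_union_self]; exact subset_union_left
    refine (measure_mono hsub).trans ((measure_union_le _ _).trans ?_)
    refine add_le_add hbox ?_
    rw [Measure.addHaar_smul, finrank_euclideanSpace_fin, abs_of_pos (by positivity)]
  set v := (volume Q).toReal with hv
  have hv0 : 0 ≤ v := ENNReal.toReal_nonneg
  have hvQ : volume Q = ENNReal.ofReal v := (ENNReal.ofReal_toReal hQfin).symm
  rw [hvQ, ← ENNReal.ofReal_pow hd0, ← ENNReal.ofReal_mul (by positivity),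
    ← ENNReal.ofReal_mul (by positivity), ← ENNReal.ofReal_add (by positivity) (by positivity),
    ENNReal.ofReal_le_ofReal_iff (by positivity)] at hvol
  rw [hsig, hvQ, hdA, ← ENNReal.ofReal_pow hd0, ← ENNReal.ofReal_natCast,
    ← ENNReal.ofReal_mul (by positivity), ← ENNReal.ofReal_mul (by positivity)]
  refine ENNReal.ofReal_le_ofReal ?_
  have hber : c ^ n * (1 + n * δ) ≤ 1 := by
    have k1 := one_add_mul_le_pow (a := δ) (by linarith) n
    have k2 : c ^ n * (1 + δ) ^ n ≤ 1 := by
      rw [← mul_pow]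
      exact pow_le_one₀ (by positivity) (by nlinarith)
    have k3 : 0 ≤ c ^ n := by positivity
    nlinarith
  rw [div_mul_eq_mul_div, div_le_iff₀ (by linarith)]
  have k4 : δ * (c ^ n * (n * v)) ≤ δ * (d ^ (n-1) * (1 + δ)) := by nlinarith
  exact le_of_mul_le_mul_left k4 h0

lemma sig_le_hausdorff (hn : 1 ≤ n) : sig n ≤ (μH[(n:ℝ) - 1] : Measure (Sph n)) := by
  have hcast : (n:ℝ) - 1 = ((n - 1 : ℕ) : ℝ) := by rw [Nat.cast_sub hn]; simp
  have key : ∀ δ : ℝ, 0 < δ → δ < 1 →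
      ENNReal.ofReal ((1 - δ) ^ n / (1 + δ)) • sig n ≤ (μH[(n:ℝ) - 1] : Measure (Sph n)) := by
    intro δ h0 h1
    refine Measure.le_hausdorffMeasure _ _ (ENNReal.ofReal δ) (by simpa using h0) fun s hs => ?_
    rw [hcast, ENNReal.rpow_natCast, ← ediam_closure]
    refine le_trans ?_ (sig_small hn h0 h1 (closure s) isClosed_closure.measurableSet
      (by rwa [ediam_closure]))
    rw [Measure.smul_apply, smul_eq_mul]
    gcongr
    exact subset_closure
  refine Measure.le_iff'.2 fun s => ?_
  have hlim : Tendsto (fun δ : ℝ => ENNReal.ofReal ((1 - δ) ^ n / (1 + δ)) * sig n s)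
      (𝓝[>] 0) (𝓝 (ENNReal.ofReal 1 * sig n s)) := by
    refine ENNReal.Tendsto.mul_const ?_ (Or.inl (by simp))
    refine ENNReal.tendsto_ofReal ?_
    have hc : ContinuousAt (fun δ : ℝ => (1 - δ) ^ n / (1 + δ)) 0 :=
      ContinuousAt.div (by fun_prop) (by fun_prop) (by norm_num)
    have := hc.tendsto
    simp only [sub_zero, one_pow, add_zero, div_one] at this
    exact this.mono_left nhdsWithin_le_nhds
  rw [ENNReal.ofReal_one, one_mul] at hlim
  refine le_of_tendsto hlim ?_
  filter_upwards [Ioo_mem_nhdsGT (zero_lt_one' ℝ)] with δ hδ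
  have := key δ hδ.1 hδ.2 s
  rwa [Measure.smul_apply, smul_eq_mul] at this


end HausLow


section HausInt

variable {n : ℕ}

lemma sphere_finite (hn : 1 ≤ n) (x : En n) {r : ℝ} (hr : 0 < r) :
    μH[(n:ℝ) - 1] (sphere x r) < ⊤ := by
  have hd : (0:ℝ) ≤ (n:ℝ) - 1 := by
    have : (1:ℝ) ≤ n := by exact_mod_cast hn
    linarith
  have hL : LipschitzWith (Real.toNNReal r) (fun y : En n => x + r • y) := by
    refine LipschitzWith.of_dist_le_mul fun a b => ?_
    rw [dist_add_left, dist_smul₀, Real.norm_eq_abs, abs_of_pos hr, Real.coe_toNNReal _ hr.le]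
  have hsub : sphere x r ⊆ (fun y : En n => x + r • y) '' (sphere 0 1) := by
    intro y hy
    refine ⟨r⁻¹ • (y - x), ?_, ?_⟩
    · have : ‖y - x‖ = r := by simpa [dist_eq_norm] using hy
      simp only [mem_sphere_zero_iff_norm, norm_smul, this, norm_inv, Real.norm_eq_abs,
        abs_of_pos hr]
      exact inv_mul_cancel₀ hr.ne'
    · simp [smul_smul, hr.ne']
  refine (measure_mono hsub).trans_lt ((hL.hausdorffMeasure_image_le hd _).trans_lt ?_)
  exact ENNReal.mul_lt_top (ENNReal.rpow_lt_top_of_nonneg hd (by simp))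
    (sphere_hausdorff_finite hn)

/-- comparison of the Hausdorff integral with the true surface integral -/
lemma sphere_integral_le (hn : 1 ≤ n) {f : En n → ℝ} {x : En n} {r : ℝ} (hr : 0 < r)
    (hf : ContinuousOn f (sphere x r)) (hf0 : ∀ y, 0 ≤ f y) :
    r ^ (n-1) * ∫ θ : Sph n, f (x + r • (θ : En n)) ∂(sig n)
      ≤ ∫ y in sphere x r, f y ∂(μH[(n:ℝ) - 1]) := by
  have hd : (0:ℝ) ≤ (n:ℝ) - 1 := by
    have : (1:ℝ) ≤ n := by exact_mod_cast hn
    linarith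
  have hcast : (n:ℝ) - 1 = ((n - 1 : ℕ) : ℝ) := by rw [Nat.cast_sub hn]; simp
  set T : Sph n → En n := fun θ => x + r • (θ : En n) with hT
  have hdist : ∀ a b, dist (T a) (T b) = r * dist a b := by
    intro a b
    simp only [hT]
    rw [dist_add_left, dist_smul₀, Real.norm_eq_abs, abs_of_pos hr, Subtype.dist_eq]
  have hTc : Continuous T := by fun_prop
  have hTa : AntilipschitzWith (Real.toNNReal r)⁻¹ T := by
    refine AntilipschitzWith.of_le_mul_dist fun a b => ?_
    rw [hdist, NNReal.coe_inv, Real.coe_toNNReal _ hr.le]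
    field_simp
    exact le_rfl
  have hTe : MeasurableEmbedding T :=
    (hTc.isClosedEmbedding hTa.injective).measurableEmbedding
  have hTs : ∀ θ, T θ ∈ sphere x r := by
    intro θ
    have : ‖(θ : En n)‖ = 1 := by simp
    simp only [hT, mem_sphere_iff_norm, add_sub_cancel_left, norm_smul, this, Real.norm_eq_abs,
      abs_of_pos hr, mul_one]
  have hle : ENNReal.ofReal (r ^ (n-1)) • (sig n).map T
      ≤ (μH[(n:ℝ) - 1] : Measure (En n)).restrict (sphere x r) := by
    refine Measure.le_iff.2 fun s hs => ?_
    rw [Measure.smul_apply, smul_eq_mul, Measure.map_apply hTc.measurable hs,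
      Measure.restrict_apply hs]
    have e1 : T ⁻¹' s = T ⁻¹' (s ∩ sphere x r) := by
      ext θ; simp only [mem_preimage, mem_inter_iff, hTs, and_true]
    have e2 : sig n (T ⁻¹' s) ≤ _ := (sig_le_hausdorff hn (T ⁻¹' s)).trans
      (e1 ▸ hTa.hausdorffMeasure_preimage_le hd (s ∩ sphere x r))
    have e3 : ((((Real.toNNReal r)⁻¹ : ℝ≥0) : ℝ≥0∞)) ^ ((n:ℝ) - 1)
        = (ENNReal.ofReal (r ^ (n-1)))⁻¹ := by
      rw [hcast, ENNReal.rpow_natCast, ENNReal.ofReal_pow hr.le,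
        ENNReal.coe_inv (by simpa using hr), ENNReal.inv_pow]
      rfl
    rw [e3] at e2
    have h0 : ENNReal.ofReal (r ^ (n-1)) ≠ 0 := by
      have : 0 < r ^ (n-1) := by positivity
      simpa using this
    calc ENNReal.ofReal (r ^ (n-1)) * sig n (T ⁻¹' s)
        ≤ ENNReal.ofReal (r ^ (n-1)) * ((ENNReal.ofReal (r ^ (n-1)))⁻¹ *
            μH[(n:ℝ) - 1] (s ∩ sphere x r)) := by gcongr
      _ = μH[(n:ℝ) - 1] (s ∩ sphere x r) := by
        rw [← mul_assoc, ENNReal.mul_inv_cancel h0 ENNReal.ofReal_ne_top, one_mul]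
  have hInteg : Integrable f ((μH[(n:ℝ) - 1] : Measure (En n)).restrict (sphere x r)) := by
    obtain ⟨M, hM⟩ := (isCompact_sphere x r).exists_bound_of_continuousOn hf
    have : IsFiniteMeasure ((μH[(n:ℝ) - 1] : Measure (En n)).restrict (sphere x r)) :=
      ⟨by rw [Measure.restrict_apply_univ]; exact sphere_finite hn x hr⟩
    refine Integrable.of_bound (C := M) ?_ ?_
    · exact hf.aestronglyMeasurable_of_isCompact (isCompact_sphere x r)
        isClosed_sphere.measurableSet
    · exact (ae_restrict_iff' isClosed_sphere.measurableSet).2 (Eventually.of_forall hM)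
  have hmain := integral_mono_measure hle (Eventually.of_forall hf0) hInteg
  rw [integral_smul_measure, hTe.integral_map, ENNReal.toReal_ofReal (by positivity),
    smul_eq_mul] at hmain
  exact hmain

end HausInt


section Assembly

variable {n : ℕ}

/-- smooth global extension of a translate -/
lemma exists_ext {Ω : Set (En n)} (hΩ : IsOpen Ω) {u : En n → ℝ}
    (hu : ContDiffOn ℝ (⊤ : ℕ∞) u Ω) {x : En n} {r : ℝ} (hr : 0 < r) (hx : closedBall x r ⊆ Ω) :
    ∃ (U : En n → ℝ) (R : ℝ), r < R ∧ ContDiff ℝ (⊤ : ℕ∞) U ∧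
      (∀ y, ‖y‖ < R → x + y ∈ Ω) ∧ ∀ y, ‖y‖ < R → U y = u (x + y) := by
  obtain ⟨δ, hδ, hsub⟩ := (isCompact_closedBall x r).exists_cthickening_subset_open hΩ hx
  rw [cthickening_closedBall hδ.le hr.le] at hsub
  have hmem : ∀ y : En n, ‖y‖ ≤ δ + r → x + y ∈ Ω := fun y hy => hsub (by simpa using hy)
  let χ : ContDiffBump (0 : En n) := ⟨r + δ / 2, δ + r, by positivity, by linarith⟩
  refine ⟨fun y => χ y * u (x + y), r + δ / 2, by linarith, ?_, fun y hy => hmem y (by linarith),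
    fun y hy => ?_⟩
  · rw [contDiff_iff_contDiffAt]
    intro y
    by_cases hy : ‖y‖ ≤ δ + r
    · have h1 : ContDiffAt ℝ (⊤ : ℕ∞) u (x + y) := hu.contDiffAt (hΩ.mem_nhds (hmem y hy))
      have h2 : ContDiffAt ℝ (⊤ : ℕ∞) (fun y => u (x + y)) y :=
        h1.comp y (contDiffAt_const.add contDiffAt_id)
      exact χ.contDiffAt.mul h2
    · have h1 : y ∉ tsupport χ := by
        rw [χ.tsupport_eq]; simpa using hy
      have h2 : (fun y => χ y * u (x + y)) =ᶠ[𝓝 y] fun _ => 0 := by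
        filter_upwards [notMem_tsupport_iff_eventuallyEq.1 h1] with z hz
        rw [hz]; simp
      exact contDiffAt_const.congr_of_eventuallyEq h2
  · have : χ y = 1 := χ.one_of_mem_closedBall (by simpa [χ] using hy.le)
    simp only [this, one_mul]

lemma translate_integral (x : En n) (s : ℝ) (g : En n → ℝ) :
    ∫ y in closedBall x s, g y = ∫ y in closedBall 0 s, g (x + y) := by
  have h := (measurePreserving_add_left (volume : Measure (En n)) x).setIntegral_preimage_emb
    (MeasurableEquiv.addLeft x).measurableEmbedding g (closedBall x s)
  rw [← h]
  congr 2
  ext y; simp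

lemma final_bound (hn : 3 ≤ n) {Ω : Set (En n)} (hΩ : IsOpen Ω) {u : En n → ℝ}
    (hu : IsYamabeSol n Ω u) {x : En n} {r : ℝ} (hr : 0 < r) (hx : closedBall x r ⊆ Ω) :
    (∫ y in closedBall x (r / 2),
          (‖gradient u y‖ ^ 2 + |u y| ^ (2 * (n : ℝ) / ((n : ℝ) - 2))))
        ≤ (2 + n * (4 * (2 + 4 / ((n:ℝ) - 2)) + 6) / 3) * Eu n u x r := by
  have h3 : (3:ℝ) ≤ n := by exact_mod_cast hn
  have hn2 : 0 < (n:ℝ) - 2 := by linarith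
  obtain ⟨U, R, hrR, hU, hmem, hUu⟩ := exists_ext hΩ hu.1 hr hx
  have hev : ∀ y : En n, ‖y‖ < R → ∀ᶠ z in 𝓝 y, ‖z‖ < R := fun y hy =>
    continuous_norm.continuousAt.eventually_lt continuousAt_const hy
  have hfd : ∀ y, ‖y‖ < R → fderiv ℝ U y = fderiv ℝ u (x + y) := by
    intro y hy
    have : U =ᶠ[𝓝 y] fun z => u (x + z) := (hev y hy).mono hUu
    rw [this.fderiv_eq, fderiv_comp_add_left]
  have hlap : ∀ y, ‖y‖ < R → lap U y = lap u (x + y) := by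
    intro y hy
    unfold lap
    refine Finset.sum_congr rfl fun i _ => ?_
    have : (fun z => fderiv ℝ U z (EuclideanSpace.single i 1)) =ᶠ[𝓝 y]
        fun z => (fun w => fderiv ℝ u w (EuclideanSpace.single i 1)) (x + z) :=
      (hev y hy).mono fun z hz => by simp only [hfd z hz]
    rw [this.fderiv_eq]
    exact congrArg (fun L : En n →L[ℝ] ℝ => L (EuclideanSpace.single i 1))
      (fderiv_comp_add_left (f := fun w => fderiv ℝ u w (EuclideanSpace.single i 1)) x)
  have heq : ∀ y, ‖y‖ < R → -lap U y = U y * |U y| ^ ((4 : ℝ) / ((n : ℝ) - 2)) := by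
    intro y hy
    rw [hlap y hy, hUu y hy]
    exact hu.2 _ (hmem y hy)
  have hgr : ∀ y, ‖y‖ < R → ‖gradient u (x + y)‖ ^ 2 = gsq U y := by
    intro y hy
    rw [gradient_normsq]
    unfold gsq pd
    rw [hfd y hy]
  have hnl : ∀ y, ‖y‖ < R → |u (x + y)| ^ (2 * (n : ℝ) / ((n : ℝ) - 2)) = nl U y := by
    intro y hy
    unfold nl
    rw [hUu y hy]
  have cg := (gsq_contDiff hU).continuous
  have cn := (nl_contDiff hn hU).continuous
  have cU := hU.continuous
  have hlt : ∀ {s : ℝ}, s ≤ r → ∀ y ∈ closedBall (0 : En n) s, ‖y‖ < R := by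
    intro s hs y hy
    have : ‖y‖ ≤ s := by simpa using hy
    linarith
  have hL : (∫ y in closedBall x (r / 2),
      (‖gradient u y‖ ^ 2 + |u y| ^ (2 * (n : ℝ) / ((n : ℝ) - 2))))
      = Ib (gsq U) (r / 2) + Ib (nl U) (r / 2) := by
    rw [translate_integral]
    have e1 : ∫ y in closedBall (0 : En n) (r / 2),
        (‖gradient u (x + y)‖ ^ 2 + |u (x + y)| ^ (2 * (n : ℝ) / ((n : ℝ) - 2)))
        = ∫ y in closedBall (0 : En n) (r / 2), (gsq U y + nl U y) := by
      refine setIntegral_congr_fun isClosed_closedBall.measurableSet fun y hy => ?_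
      have := hlt (by linarith) y hy
      simp only [hgr y this, hnl y this]
    have cs : Continuous fun y => gsq U y + nl U y := cg.add cn
    rw [e1, closedBall_integral (by omega) cs (by positivity)]
    have e2 := Ib_sub cs cn (r / 2)
    simp only [add_sub_cancel_right] at e2
    linarith
  have hE : (∫ y in closedBall x r,
      ((1 : ℝ) / 2 * ‖gradient u y‖ ^ 2
        - ((n : ℝ) - 2) / (2 * n) * |u y| ^ (2 * (n : ℝ) / ((n : ℝ) - 2))))
      = 1 / 2 * Ib (gsq U) r - ((n:ℝ) - 2) / (2 * n) * Ib (nl U) r := by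
    rw [translate_integral]
    have e1 : ∫ y in closedBall (0 : En n) r, ((1 : ℝ) / 2 * ‖gradient u (x + y)‖ ^ 2
        - ((n : ℝ) - 2) / (2 * n) * |u (x + y)| ^ (2 * (n : ℝ) / ((n : ℝ) - 2)))
        = ∫ y in closedBall (0 : En n) r,
          (1 / 2 * gsq U y - ((n : ℝ) - 2) / (2 * n) * nl U y) := by
      refine setIntegral_congr_fun isClosed_closedBall.measurableSet fun y hy => ?_
      have := hlt le_rfl y hy
      simp only [hgr y this, hnl y this]
    rw [e1, closedBall_integral (by omega) (by fun_prop) hr,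
      Ib_sub (by fun_prop) (by fun_prop), Ib_const_mul, Ib_const_mul]
  have hS : r ^ (n-1) * Av (fun y => U y * U y) r
      ≤ ∫ y in sphere x r, (u y) ^ 2 ∂(μH[(n : ℝ) - 1]) := by
    have hc : ContinuousOn (fun y => (u y) ^ 2) (sphere x r) :=
      (hu.1.continuousOn.mono (sphere_subset_closedBall.trans hx)).pow 2
    refine le_trans (le_of_eq ?_) (sphere_integral_le (by omega) hr hc fun y => sq_nonneg _)
    congr 1
    unfold Av
    refine integral_congr_ae (Eventually.of_forall fun θ => ?_)
    have h1 : ‖(θ : En n)‖ = 1 := by simp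
    have : ‖r • (θ : En n)‖ < R := by
      rw [norm_smul, h1, mul_one, Real.norm_eq_abs, abs_of_pos hr]; exact hrR
    simp only [hUu _ this]
    ring
  rw [hL]
  refine (core_bound hn hU heq hr hrR).trans ?_
  unfold Eu
  rw [hE]
  gcongr

end Assembly

/-- there is a constant `C > 0` depending only on `n` such that for every
smooth solution and every closed ball `B(x,r) ⊆ Ω`,
`∫_{B(x,r/2)} (|∇u|² + |u|^{2n/(n-2)}) ≤ C ⬝ E_u(x,r)`. -/
theorem energy_bounded_by_Eu {n : ℕ} (hn : 3 ≤ n) :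
    ∃ C > (0 : ℝ),
      ∀ (Ω : Set (En n)), IsOpen Ω →
      ∀ u : En n → ℝ, IsYamabeSol n Ω u →
      ∀ (x : En n) (r : ℝ), 0 < r → closedBall x r ⊆ Ω →
      (∫ y in closedBall x (r / 2),
          (‖gradient u y‖ ^ 2 + |u y| ^ (2 * (n : ℝ) / ((n : ℝ) - 2))))
        ≤ C * Eu n u x r := by
  have h3 : (3:ℝ) ≤ n := by exact_mod_cast hn
  have hn2 : 0 < (n:ℝ) - 2 := by linarith
  exact ⟨2 + n * (4 * (2 + 4 / ((n:ℝ) - 2)) + 6) / 3, by positivity,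
    fun Ω hΩ u hu x r hr hx => final_bound hn hΩ hu hr hx⟩

end
end
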